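/- arXiv:1905.04636 — 2 statements merged into one kernel-verified Lean document; each statement's English description precedes it below -/
import Mathlib

section
/- There exists a constant C > 0 such that for all positive integers n, r with \sqrt{n \log n} \le r \le n, writing u = n/r and \nu(n,r) = |S_n^r|/n!, one has |\nu(n,r) - \rho(u)| \le C \rho(u) \cdot u \log(u+1)/r, i.e. \nu(n,r) = \rho(u)(1 + O(u \log(u+1)/r)). -/
open scoped Classical

/-- The length of the cycle of `σ` containing `a`. -/
noncomputable def cycLen {n : ℕ} (σ : Equiv.Perm (Fin n)) (a : Fin n) : ℕ :=
  (Finset.univ.filter (fun b => σ.SameCycle a b)).card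

/-- `S_n^r`: permutations of `{1,...,n}` all of whose cycles have length at most `r`. -/
noncomputable def Snr (n r : ℕ) : Finset (Equiv.Perm (Fin n)) :=
  Finset.univ.filter (fun σ => ∀ a, cycLen σ a ≤ r)

/-- `W_k(σ)`: the number of cycles of `σ` of length `k`. -/
noncomputable def cycleCount {n : ℕ} (σ : Equiv.Perm (Fin n)) (k : ℕ) : ℕ :=
  (Finset.univ.filter (fun a => cycLen σ a = k)).card / k

/-- The set of transpositions of `{1,...,n}`. -/
noncomputable def transps (n : ℕ) : Finset (Equiv.Perm (Fin n)) :=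
  Finset.univ.filter (fun τ => τ.IsSwap)

/-- `σ' = τ ∘ σ` if `τ ∘ σ ∈ S_n^r`, and `σ' = σ` otherwise. -/
noncomputable def step (n r : ℕ) (σ τ : Equiv.Perm (Fin n)) : Equiv.Perm (Fin n) :=
  if τ * σ ∈ Snr n r then τ * σ else σ

/-- The order `∏ i, i ^ mᵢ * mᵢ!` of the centralizer of a permutation whose cycle lengths
(fixed points included) form the multiset `m`. -/
noncomputable def centralizerOrder (m : Multiset ℕ) : ℕ :=
  m.prod * ∏ i ∈ m.toFinset, (m.count i).factorial

/-- Partitions of `n` into parts of size at most `r`, as multisets. -/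
noncomputable def boundedPartitions (n r : ℕ) : Finset (Multiset ℕ) :=
  ((Finset.univ : Finset n.Partition).image (·.parts)).filter (fun m => ∀ i ∈ m, i ≤ r)

theorem mem_boundedPartitions {n r : ℕ} {m : Multiset ℕ} :
    m ∈ boundedPartitions n r ↔ m.sum = n ∧ ∀ i ∈ m, 0 < i ∧ i ≤ r := by
  simp only [boundedPartitions, Finset.mem_filter, Finset.mem_image, Finset.mem_univ, true_and]
  constructor
  · rintro ⟨⟨p, rfl⟩, h⟩
    exact ⟨p.parts_sum, fun i hi => ⟨p.parts_pos hi, h i hi⟩⟩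
  · rintro ⟨hs, h⟩
    exact ⟨⟨⟨m, fun hi => (h _ hi).1, hs⟩, rfl⟩, fun i hi => (h i hi).2⟩

theorem centralizerOrder_eq_of_subset {m : Multiset ℕ} {S : Finset ℕ} (h : m.toFinset ⊆ S) :
    centralizerOrder m = m.prod * ∏ i ∈ S, (m.count i).factorial := by
  rw [centralizerOrder]
  congr 1
  refine Finset.prod_subset h fun i _ hi => ?_
  rw [Multiset.count_eq_zero_of_notMem (by simpa using hi), Nat.factorial_zero]

theorem centralizerOrder_cons (k : ℕ) (m : Multiset ℕ) :
    centralizerOrder (k ::ₘ m) = k * (m.count k + 1) * centralizerOrder m := by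
  have hk : k ∈ insert k m.toFinset := Finset.mem_insert_self _ _
  rw [centralizerOrder_eq_of_subset (m := m) (Finset.subset_insert k _),
    centralizerOrder_eq_of_subset (m := k ::ₘ m) (S := insert k m.toFinset) (by simp),
    ← Finset.mul_prod_erase _ _ hk, ← Finset.mul_prod_erase _ _ hk,
    Multiset.count_cons_self, Nat.factorial_succ, Multiset.prod_cons]
  have : ∏ x ∈ (insert k m.toFinset).erase k, ((k ::ₘ m).count x).factorial
      = ∏ x ∈ (insert k m.toFinset).erase k, (m.count x).factorial :=
    Finset.prod_congr rfl fun x hx => by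
      rw [Multiset.count_cons_of_ne (Finset.ne_of_mem_erase hx)]
  rw [this]
  ring

theorem centralizerOrder_pos {m : Multiset ℕ} (h : ∀ i ∈ m, 0 < i) : 0 < centralizerOrder m := by
  refine Nat.mul_pos (Nat.pos_of_ne_zero fun h0 => ?_)
    (Finset.prod_pos fun i _ => Nat.factorial_pos _)
  exact lt_irrefl 0 (h 0 (Multiset.prod_eq_zero_iff.1 h0))

theorem eq_filter_add_replicate_one {m : Multiset ℕ} (h : ∀ i ∈ m, 0 < i) :
    m = m.filter (2 ≤ ·) + Multiset.replicate (m.count 1) 1 := by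
  conv_lhs => rw [← Multiset.filter_add_not (2 ≤ ·) m]
  congr 1
  rw [← Multiset.filter_eq']
  refine Multiset.filter_congr fun x hx => ?_
  have := h x hx
  omega

theorem cycLen_eq_one {n : ℕ} {σ : Equiv.Perm (Fin n)} {a : Fin n} (h : σ a = a) :
    cycLen σ a = 1 := by
  rw [cycLen, Finset.card_eq_one]
  refine ⟨a, Finset.ext fun b => ?_⟩
  simp only [Finset.mem_filter, Finset.mem_univ, true_and, Finset.mem_singleton]
  exact ⟨fun hb => (hb.eq_of_left h).symm, fun hb => hb ▸ Equiv.Perm.SameCycle.refl _ _⟩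

theorem cycLen_eq_card_support {n : ℕ} {σ : Equiv.Perm (Fin n)} {a : Fin n} (h : σ a ≠ a) :
    cycLen σ a = (σ.cycleOf a).support.card := by
  rw [cycLen]
  congr 1
  ext b
  rw [Equiv.Perm.mem_support_cycleOf_iff' h]
  simp

theorem mem_partition_parts_iff {n : ℕ} {σ : Equiv.Perm (Fin n)} {i : ℕ} :
    i ∈ σ.partition.parts ↔ ∃ a, cycLen σ a = i := by
  rw [Equiv.Perm.parts_partition, Multiset.mem_add, Multiset.mem_replicate,
    Equiv.Perm.cycleType_def, Multiset.mem_map]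
  constructor
  · rintro (⟨c, hc, rfl⟩ | ⟨h, rfl⟩)
    · have hc : c ∈ σ.cycleFactorsFinset := hc
      obtain ⟨a, ha⟩ := (Equiv.Perm.mem_cycleFactorsFinset_iff.1 hc).1.nonempty_support
      have hca := Equiv.Perm.cycle_is_cycleOf ha hc
      refine ⟨a, ?_⟩
      rw [cycLen_eq_card_support, ← hca, Function.comp_apply]
      exact Equiv.Perm.mem_support.1 (Equiv.Perm.mem_cycleFactorsFinset_support_le hc ha)
    · have : σ.support ≠ Finset.univ := fun h' => h (by rw [h', Finset.card_univ, Nat.sub_self])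
      obtain ⟨a, ha⟩ : ∃ a, a ∉ σ.support := by
        by_contra! hall
        exact this (Finset.eq_univ_iff_forall.2 hall)
      exact ⟨a, cycLen_eq_one (Equiv.Perm.notMem_support.1 ha)⟩
  · rintro ⟨a, rfl⟩
    by_cases h : σ a = a
    · right
      refine ⟨?_, cycLen_eq_one h⟩
      have : σ.support.card < Fintype.card (Fin n) :=
        Finset.card_lt_univ_of_notMem (x := a) (by simpa using h)
      omega
    · left
      refine ⟨σ.cycleOf a, ?_, (cycLen_eq_card_support h).symm⟩
      exact Equiv.Perm.cycleOf_mem_cycleFactorsFinset_iff.2 (Equiv.Perm.mem_support.2 h)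

theorem mem_Snr_iff {n r : ℕ} {σ : Equiv.Perm (Fin n)} :
    σ ∈ Snr n r ↔ ∀ i ∈ σ.partition.parts, i ≤ r := by
  simp [Snr, mem_partition_parts_iff]

theorem card_partition_parts_eq {n : ℕ} {m : Multiset ℕ} (hs : m.sum = n) (h : ∀ i ∈ m, 0 < i) :
    (Finset.univ.filter fun σ : Equiv.Perm (Fin n) => σ.partition.parts = m).card
      * centralizerOrder m = n.factorial := by
  set m₂ := m.filter (2 ≤ ·) with hm₂
  set c := m.count 1
  have hm : m = m₂ + Multiset.replicate c 1 := eq_filter_add_replicate_one h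
  have hsum : m₂.sum + c = n := by
    conv_rhs => rw [← hs, hm]
    simp
  have hfil : (Finset.univ.filter fun σ : Equiv.Perm (Fin n) => σ.partition.parts = m)
      = Finset.univ.filter fun σ : Equiv.Perm (Fin n) => σ.cycleType = m₂ := by
    refine Finset.filter_congr fun σ _ => ⟨fun hσ => ?_, fun hσ => ?_⟩
    · rw [← Equiv.Perm.filter_parts_partition_eq_cycleType, hσ]
    · rw [Equiv.Perm.parts_partition, ← Equiv.Perm.sum_cycleType, hσ, Fintype.card_fin, hm]
      congr 2
      omega
  have h1 : 1 ∉ m₂ := fun h1 => by simpa using (Multiset.mem_filter.1 h1).2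
  have hz : centralizerOrder m = (n - m₂.sum).factorial * m₂.prod *
      ∏ i ∈ m₂.toFinset, (m₂.count i).factorial := by
    have hsub : m.toFinset ⊆ insert 1 m₂.toFinset := by
      intro i hi
      rw [Multiset.mem_toFinset, hm, Multiset.mem_add, Multiset.mem_replicate] at hi
      rw [Finset.mem_insert, Multiset.mem_toFinset]
      tauto
    rw [centralizerOrder_eq_of_subset hsub, Finset.prod_insert (by simpa using h1)]
    have e1 : m.prod = m₂.prod := by
      conv_lhs => rw [hm]
      simp
    have e2 : n - m₂.sum = c := by omega
    have e3 : ∏ i ∈ m₂.toFinset, (m.count i).factorial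
        = ∏ i ∈ m₂.toFinset, (m₂.count i).factorial :=
      Finset.prod_congr rfl fun i hi => by
        have : i ≠ 1 := fun h' => h1 (by simpa [h'] using hi)
        conv_lhs => rw [hm]
        rw [Multiset.count_add, Multiset.count_replicate, if_neg this.symm, add_zero]
    rw [e1, e2, e3]
    ring
  have key := Equiv.Perm.card_of_cycleType_mul_eq (α := Fin n) m₂
  rw [if_pos ⟨by simp; omega, fun a ha => (Multiset.mem_filter.1 ha).2⟩, Fintype.card_fin] at key
  rw [hfil, hz, ← key]

theorem card_Snr_div_factorial (n r : ℕ) :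
    ((Snr n r).card : ℝ) / n.factorial
      = ∑ m ∈ boundedPartitions n r, (1 : ℝ) / centralizerOrder m := by
  rw [Finset.card_eq_sum_card_fiberwise (f := fun σ : Equiv.Perm (Fin n) => σ.partition.parts)
    (t := boundedPartitions n r), Nat.cast_sum, Finset.sum_div]
  · refine Finset.sum_congr rfl fun m hm => ?_
    obtain ⟨hs, hm⟩ := mem_boundedPartitions.1 hm
    have hpos := centralizerOrder_pos fun i hi => (hm i hi).1
    have hcard := card_partition_parts_eq hs fun i hi => (hm i hi).1
    have hfil : (Snr n r).filter (fun σ => σ.partition.parts = m)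
        = Finset.univ.filter fun σ : Equiv.Perm (Fin n) => σ.partition.parts = m := by
      ext σ
      simp only [Finset.mem_filter, Finset.mem_univ, true_and, and_iff_right_iff_imp]
      rintro rfl
      exact mem_Snr_iff.2 fun i hi => (hm i hi).2
    rw [hfil, ← hcard, Nat.cast_mul]
    have hne : ((Finset.univ.filter fun σ : Equiv.Perm (Fin n) =>
        σ.partition.parts = m).card : ℝ) ≠ 0 := by
      intro h0
      rw [Nat.cast_eq_zero.1 h0, zero_mul] at hcard
      exact (Nat.factorial_pos n).ne hcard
    have : (centralizerOrder m : ℝ) ≠ 0 := by exact_mod_cast hpos.ne'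
    field_simp
  · intro σ hσ
    refine mem_boundedPartitions.2 ⟨?_, fun i hi => ⟨σ.partition.parts_pos hi,
      mem_Snr_iff.1 hσ i hi⟩⟩
    simpa using σ.partition.parts_sum

/-- The proportion `ν(n,r)` of permutations in `S_n` without cycles longer than `r`. -/
noncomputable def smoothProportion (r n : ℕ) : ℝ := ((Snr n r).card : ℝ) / n.factorial

theorem mul_smoothProportion (n r : ℕ) :
    (n : ℝ) * smoothProportion r n
      = ∑ k ∈ Finset.Icc 1 (min r n), smoothProportion r (n - k) := by
  simp only [smoothProportion, card_Snr_div_factorial]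
  have hl : ∀ m ∈ boundedPartitions n r, (n : ℝ) * (1 / centralizerOrder m)
      = ∑ k ∈ m.toFinset, (1 : ℝ) / centralizerOrder (m.erase k) := by
    intro m hm
    obtain ⟨hs, hm⟩ := mem_boundedPartitions.1 hm
    have hn : (n : ℝ) = ∑ k ∈ m.toFinset, (m.count k : ℝ) * k := by
      rw [← hs, Finset.sum_multiset_count]
      push_cast
      simp
    rw [hn, Finset.sum_mul]
    refine Finset.sum_congr rfl fun k hk => ?_
    have hk := Multiset.mem_toFinset.1 hk
    have h1 := centralizerOrder_cons k (m.erase k)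
    rw [Multiset.cons_erase hk, Multiset.count_erase_self,
      Nat.sub_add_cancel (Multiset.one_le_count_iff_mem.2 hk)] at h1
    have h2 : (centralizerOrder (m.erase k) : ℝ) ≠ 0 := by
      exact_mod_cast (centralizerOrder_pos fun i hi => (hm i (Multiset.mem_of_mem_erase hi)).1).ne'
    have h3 : (k : ℝ) ≠ 0 := by exact_mod_cast (hm k hk).1.ne'
    have h4 : (m.count k : ℝ) ≠ 0 := by exact_mod_cast (Multiset.count_pos.2 hk).ne'
    rw [h1]
    push_cast
    field_simp
  rw [Finset.mul_sum, Finset.sum_congr rfl hl, Finset.sum_sigma', Finset.sum_sigma']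
  refine Finset.sum_bij' (fun x _ => ⟨x.2, x.1.erase x.2⟩) (fun y _ => ⟨y.1 ::ₘ y.2, y.1⟩)
    ?_ ?_ ?_ ?_ ?_
  · rintro ⟨m, k⟩ h
    simp only [Finset.mem_sigma, Multiset.mem_toFinset, mem_boundedPartitions] at h
    obtain ⟨⟨hs, hm⟩, hk⟩ := h
    have hsum : k + (m.erase k).sum = n := by rw [← hs, Multiset.sum_erase hk]
    have := hm k hk
    simp only [Finset.mem_sigma, mem_boundedPartitions, Finset.mem_Icc]
    refine ⟨⟨by omega, le_min (by omega) (by omega)⟩, by omega,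
      fun i hi => hm i (Multiset.mem_of_mem_erase hi)⟩
  · rintro ⟨k, m⟩ h
    simp only [Finset.mem_sigma, mem_boundedPartitions, Finset.mem_Icc, le_min_iff] at h
    obtain ⟨hk, hs, hm⟩ := h
    simp only [Finset.mem_sigma, Multiset.mem_toFinset, mem_boundedPartitions]
    refine ⟨⟨by rw [Multiset.sum_cons]; omega, fun i hi => ?_⟩, Multiset.mem_cons_self _ _⟩
    rcases Multiset.mem_cons.1 hi with rfl | hi
    · omega
    · exact hm i hi
  · rintro ⟨m, k⟩ h
    simp only [Finset.mem_sigma, Multiset.mem_toFinset] at h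
    simp [Multiset.cons_erase h.2]
  · rintro ⟨k, m⟩ _
    simp
  · rintro ⟨m, k⟩ _
    rfl

theorem smoothProportion_of_le {n r : ℕ} (h : n ≤ r) : smoothProportion r n = 1 := by
  have : Snr n r = Finset.univ := by
    refine Finset.eq_univ_iff_forall.2 fun σ => ?_
    simp only [Snr, Finset.mem_filter, Finset.mem_univ, true_and]
    exact fun a => ((Finset.card_le_univ _).trans (Fintype.card_fin n).le).trans h
  rw [smoothProportion, this, Finset.card_univ, Fintype.card_perm, Fintype.card_fin,
    div_self (by exact_mod_cast n.factorial_ne_zero)]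

/-- The defining properties of the Dickman function. -/
structure IsDickman (ρ : ℝ → ℝ) : Prop where
  eq_one : ∀ t : ℝ, 0 ≤ t → t ≤ 1 → ρ t = 1
  continuousOn : ContinuousOn ρ (Set.Ici 0)
  hasDerivAt : ∀ t : ℝ, 1 < t → HasDerivAt ρ (-ρ (t - 1) / t) t

/-- A continuous function on `[a, ∞)` that is positive wherever it is positive at all earlier points
is positive everywhere. -/
theorem pos_of_forall_lt_pos {g : ℝ → ℝ} {a : ℝ} (hg : ContinuousOn g (Set.Ici a))
    (h : ∀ u, a ≤ u → (∀ t, a ≤ t → t < u → 0 < g t) → 0 < g u) {u : ℝ} (hu : a ≤ u) :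
    0 < g u := by
  by_contra hneg
  set S := Set.Ici a ∩ g ⁻¹' Set.Iic 0
  have hS : IsClosed S := hg.preimage_isClosed_of_isClosed isClosed_Ici isClosed_Iic
  have hb : BddBelow S := ⟨a, fun x hx => hx.1⟩
  have hmem : sInf S ∈ S := hS.csInf_mem ⟨u, hu, not_lt.1 hneg⟩ hb
  refine (h _ hmem.1 fun t hat ht => ?_).not_ge hmem.2
  by_contra hgt
  exact ht.not_ge (csInf_le hb ⟨hat, not_lt.1 hgt⟩)

namespace IsDickman

variable {ρ : ℝ → ℝ}

/-- A primitive of `ρ` on `[0, ∞)`. -/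
noncomputable def primitive (ρ : ℝ → ℝ) (t : ℝ) : ℝ := ∫ x in (0 : ℝ)..t, ρ (max x 0)

theorem hasDerivAt_primitive (h : IsDickman ρ) {t : ℝ} (ht : 0 ≤ t) :
    HasDerivAt (primitive ρ) (ρ t) t := by
  have hc : Continuous fun x : ℝ => ρ (max x 0) :=
    h.continuousOn.comp_continuous (by fun_prop) fun x => Set.mem_Ici.2 (le_max_right _ _)
  have := intervalIntegral.integral_hasDerivAt_right (hc.intervalIntegrable 0 t)
    (hc.stronglyMeasurableAtFilter _ _) hc.continuousAt
  rwa [max_eq_left ht] at this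

theorem continuousOn_primitive (h : IsDickman ρ) : ContinuousOn (primitive ρ) (Set.Ici 0) :=
  fun _ ht => (h.hasDerivAt_primitive ht).continuousAt.continuousWithinAt

theorem hasDerivAt_mul (h : IsDickman ρ) {t : ℝ} (ht : 1 < t) :
    HasDerivAt (fun x => x * ρ x) (ρ t - ρ (t - 1)) t := by
  have := (hasDerivAt_id t).mul (h.hasDerivAt t ht)
  refine this.congr_deriv ?_
  have : t ≠ 0 := by linarith
  simp only [id]
  field_simp
  ring

theorem continuousOn_comp_sub_one (h : IsDickman ρ) :
    ContinuousOn (fun t => ρ (t - 1)) (Set.Ici 1) :=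
  h.continuousOn.comp (by fun_prop) fun t ht => by
    simp only [Set.mem_Ici] at ht ⊢; linarith

theorem mul_eq_primitive_sub (h : IsDickman ρ) {t : ℝ} (ht : 1 ≤ t) :
    t * ρ t = primitive ρ t - primitive ρ (t - 1) := by
  set g : ℝ → ℝ := fun x => x * ρ x - (primitive ρ x - primitive ρ (x - 1)) with hgdef
  have hsub : Set.Ici (1 : ℝ) ⊆ Set.Ici 0 := Set.Ici_subset_Ici.2 zero_le_one
  have hg : ContinuousOn g (Set.Ici 1) := by
    refine (continuousOn_id.mul (h.continuousOn.mono hsub)).sub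
      ((h.continuousOn_primitive.mono hsub).sub
        (h.continuousOn_primitive.comp (by fun_prop) fun x hx => ?_))
    simp only [Set.mem_Ici] at hx ⊢; linarith
  have hd : ∀ x ∈ interior (Set.Ici (1 : ℝ)), HasDerivAt g 0 x := by
    intro x hx
    rw [interior_Ici] at hx
    have hx : 1 < x := hx
    have h1 := h.hasDerivAt_primitive (t := x) (by linarith)
    have h2 := (h.hasDerivAt_primitive (t := x - 1) (by linarith)).comp_sub_const x 1
    exact ((h.hasDerivAt_mul hx).sub (h1.sub h2)).congr_deriv (by ring)
  have hdiff : DifferentiableOn ℝ g (interior (Set.Ici 1)) :=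
    fun x hx => (hd x hx).differentiableAt.differentiableWithinAt
  have hmono := monotoneOn_of_deriv_nonneg (convex_Ici 1) hg hdiff fun x hx => (hd x hx).deriv.ge
  have hanti := antitoneOn_of_deriv_nonpos (convex_Ici 1) hg hdiff fun x hx => (hd x hx).deriv.le
  have h0 : g t = g 1 := le_antisymm (hanti Set.self_mem_Ici ht ht) (hmono Set.self_mem_Ici ht ht)
  have h1 : g 1 = 0 := by
    have hint : primitive ρ 1 = 1 := by
      rw [primitive, intervalIntegral.integral_congr (g := fun _ => (1 : ℝ))]
      · simp
      · intro x hx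
        rw [Set.uIcc_of_le zero_le_one] at hx
        simp only [max_eq_left hx.1]
        exact h.eq_one x hx.1 hx.2
    simp only [hgdef, sub_self, hint, h.eq_one 1 zero_le_one le_rfl]
    simp [primitive]
  rw [h1] at h0
  simp only [hgdef] at h0
  linarith

theorem pos (h : IsDickman ρ) {t : ℝ} (ht : 0 ≤ t) : 0 < ρ t := by
  refine pos_of_forall_lt_pos h.continuousOn (fun u hu hlt => ?_) ht
  rcases le_or_gt u 1 with h1 | h1
  · rw [h.eq_one u hu h1]; exact one_pos
  have hmono : StrictMonoOn (primitive ρ) (Set.Icc (u - 1) u) := by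
    refine strictMonoOn_of_deriv_pos (convex_Icc _ _) (h.continuousOn_primitive.mono fun x hx => ?_)
      fun x hx => ?_
    · simp only [Set.mem_Ici]; linarith [hx.1]
    · rw [interior_Icc] at hx
      have hx0 : 0 ≤ x := by linarith [hx.1]
      rw [(h.hasDerivAt_primitive hx0).deriv]
      exact hlt x hx0 hx.2
  have := hmono (Set.left_mem_Icc.2 (by linarith)) (Set.right_mem_Icc.2 (by linarith))
    (by linarith : u - 1 < u)
  refine pos_of_mul_pos_right (a := u) ?_ (by linarith)
  rw [h.mul_eq_primitive_sub h1.le]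
  linarith

theorem antitoneOn (h : IsDickman ρ) : AntitoneOn ρ (Set.Ici 0) := by
  have h1 : AntitoneOn ρ (Set.Icc 0 1) := fun a ha b hb _ => by
    rw [h.eq_one a ha.1 ha.2, h.eq_one b hb.1 hb.2]
  have h2 : AntitoneOn ρ (Set.Ici 1) := by
    refine antitoneOn_of_deriv_nonpos (convex_Ici 1)
      (h.continuousOn.mono (Set.Ici_subset_Ici.2 zero_le_one)) ?_ ?_
    all_goals
      intro x hx
      rw [interior_Ici] at hx
      have hx : 1 < x := hx
    · exact (h.hasDerivAt x hx).differentiableAt.differentiableWithinAt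
    · rw [(h.hasDerivAt x hx).deriv]
      have := h.pos (t := x - 1) (by linarith)
      exact div_nonpos_of_nonpos_of_nonneg (by linarith) (by linarith)
  have := h1.union_right h2 (isGreatest_Icc zero_le_one) isLeast_Ici
  rwa [Set.Icc_union_Ici_eq_Ici zero_le_one] at this

theorem le_one (h : IsDickman ρ) {t : ℝ} (ht : 0 ≤ t) : ρ t ≤ 1 := by
  rw [← h.eq_one 0 le_rfl zero_le_one]
  exact h.antitoneOn Set.self_mem_Ici ht ht

theorem lt_one (h : IsDickman ρ) {t : ℝ} (ht : 1 < t) (ht2 : t ≤ 2) : ρ t < 1 := by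
  have hanti : StrictAntiOn ρ (Set.Icc 1 2) := by
    refine strictAntiOn_of_deriv_neg (convex_Icc 1 2)
      (h.continuousOn.mono fun x hx => zero_le_one.trans hx.1) fun x hx => ?_
    rw [interior_Icc] at hx
    rw [(h.hasDerivAt x hx.1).deriv, h.eq_one (x - 1) (by linarith [hx.1]) (by linarith [hx.2])]
    exact div_neg_of_neg_of_pos (by norm_num) (by linarith [hx.1])
  rw [← h.eq_one 1 zero_le_one le_rfl]
  exact hanti (by norm_num) ⟨ht.le, ht2⟩ ht

theorem sub_mul_le_primitive_sub (h : IsDickman ρ) {a b : ℝ} (ha : 0 ≤ a) (hab : a ≤ b) :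
    (b - a) * ρ b ≤ primitive ρ b - primitive ρ a := by
  have := (convex_Icc a b).mul_sub_le_image_sub_of_le_deriv (f := primitive ρ) (C := ρ b)
    (h.continuousOn_primitive.mono fun x hx => ha.trans hx.1)
    (fun x hx => (h.hasDerivAt_primitive
      (ha.trans (interior_subset hx).1)).differentiableAt.differentiableWithinAt)
    (fun x hx => by
      have hx := interior_subset hx
      rw [(h.hasDerivAt_primitive (ha.trans hx.1)).deriv]
      exact h.antitoneOn (ha.trans hx.1) (ha.trans hab) hx.2)
    a (Set.left_mem_Icc.2 hab) b (Set.right_mem_Icc.2 hab) hab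
  linarith

theorem primitive_sub_le_sub_mul (h : IsDickman ρ) {a b : ℝ} (ha : 0 ≤ a) (hab : a ≤ b) :
    primitive ρ b - primitive ρ a ≤ (b - a) * ρ a := by
  have := (convex_Icc a b).image_sub_le_mul_sub_of_deriv_le (f := primitive ρ) (C := ρ a)
    (h.continuousOn_primitive.mono fun x hx => ha.trans hx.1)
    (fun x hx => (h.hasDerivAt_primitive
      (ha.trans (interior_subset hx).1)).differentiableAt.differentiableWithinAt)
    (fun x hx => by
      have hx := interior_subset hx
      rw [(h.hasDerivAt_primitive (ha.trans hx.1)).deriv]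
      exact h.antitoneOn ha (ha.trans hx.1) hx.1)
    a (Set.left_mem_Icc.2 hab) b (Set.right_mem_Icc.2 hab) hab
  linarith

/-- The decay rate `-ρ'(t)/ρ(t)`. -/
noncomputable def decay (ρ : ℝ → ℝ) (t : ℝ) : ℝ := ρ (t - 1) / (t * ρ t)

theorem continuousOn_decay (h : IsDickman ρ) : ContinuousOn (decay ρ) (Set.Ici 1) := by
  refine h.continuousOn_comp_sub_one.div (continuousOn_id.mul
    (h.continuousOn.mono (Set.Ici_subset_Ici.2 zero_le_one))) fun t ht => ?_
  have ht : (1 : ℝ) ≤ t := ht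
  exact (mul_pos (zero_lt_one.trans_le ht) (h.pos (by linarith))).ne'

theorem decay_mul (h : IsDickman ρ) {t : ℝ} (ht : 1 ≤ t) : decay ρ t * ρ t = ρ (t - 1) / t := by
  have : ρ t ≠ 0 := (h.pos (by linarith)).ne'
  have : t ≠ 0 := by linarith
  rw [decay]
  field_simp

theorem hasDerivAt' (h : IsDickman ρ) {t : ℝ} (ht : 1 < t) :
    HasDerivAt ρ (-(decay ρ t * ρ t)) t := by
  rw [h.decay_mul ht.le, ← neg_div]
  exact h.hasDerivAt t ht

theorem strictMonoOn_decay_Icc_one_two (h : IsDickman ρ) :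
    StrictMonoOn (decay ρ) (Set.Icc 1 2) := by
  have hanti : StrictAntiOn (fun t => t * ρ t) (Set.Icc 1 2) := by
    refine strictAntiOn_of_deriv_neg (convex_Icc 1 2) (continuousOn_id.mul
      (h.continuousOn.mono fun x hx => zero_le_one.trans hx.1)) fun x hx => ?_
    rw [interior_Icc] at hx
    rw [(h.hasDerivAt_mul hx.1).deriv, h.eq_one (x - 1) (by linarith [hx.1]) (by linarith [hx.2])]
    linarith [h.lt_one hx.1 hx.2.le]
  intro a ha b hb hab
  rw [decay, decay, h.eq_one (a - 1) (by linarith [ha.1]) (by linarith [ha.2]),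
    h.eq_one (b - 1) (by linarith [hb.1]) (by linarith [hb.2])]
  exact one_div_lt_one_div_of_lt
    (mul_pos (by linarith [hb.1]) (h.pos (by linarith [hb.1]))) (hanti ha hb hab)

/-- The quantity whose sign is that of the derivative of `decay ρ` on `(2, ∞)`. -/
noncomputable def decayGap (ρ : ℝ → ℝ) (t : ℝ) : ℝ :=
  ρ (t - 1) - ρ t - decay ρ (t - 1) * (t * ρ t)

theorem continuousOn_decayGap (h : IsDickman ρ) : ContinuousOn (decayGap ρ) (Set.Ici 2) := by
  have h1 : Set.Ici (2 : ℝ) ⊆ Set.Ici 1 := Set.Ici_subset_Ici.2 one_le_two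
  have h0 : Set.Ici (2 : ℝ) ⊆ Set.Ici 0 := Set.Ici_subset_Ici.2 zero_le_two
  refine ((h.continuousOn_comp_sub_one.mono h1).sub (h.continuousOn.mono h0)).sub
    (ContinuousOn.mul (h.continuousOn_decay.comp (by fun_prop) fun t ht => ?_)
      (continuousOn_id.mul (h.continuousOn.mono h0)))
  simp only [Set.mem_Ici] at ht ⊢; linarith

theorem hasDerivAt_decay (h : IsDickman ρ) {t : ℝ} (ht : 2 < t) :
    HasDerivAt (decay ρ) (ρ (t - 1) * decayGap ρ t / (t * ρ t) ^ 2) t := by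
  have h1 := (h.hasDerivAt' (t := t - 1) (by linarith)).comp_sub_const t 1
  have hne : t * ρ t ≠ 0 := (mul_pos (by linarith) (h.pos (by linarith))).ne'
  refine (h1.div (h.hasDerivAt_mul (by linarith)) hne).congr_deriv ?_
  rw [decayGap]
  congr 1
  ring

theorem strictMonoOn_decay_of_decayGap_pos (h : IsDickman ρ) {u : ℝ} (hu : 2 ≤ u)
    (hpos : ∀ t, 2 ≤ t → t < u → 0 < decayGap ρ t) : StrictMonoOn (decay ρ) (Set.Icc 1 u) := by
  have h2 : StrictMonoOn (decay ρ) (Set.Icc 2 u) := by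
    refine strictMonoOn_of_deriv_pos (convex_Icc 2 u)
      (h.continuousOn_decay.mono fun x hx => one_le_two.trans hx.1) fun x hx => ?_
    rw [interior_Icc] at hx
    rw [(h.hasDerivAt_decay hx.1).deriv]
    exact div_pos (mul_pos (h.pos (by linarith [hx.1])) (hpos x hx.1.le hx.2))
      (pow_pos (mul_pos (by linarith [hx.1]) (h.pos (by linarith [hx.1]))) 2)
  have := h.strictMonoOn_decay_Icc_one_two.union h2 (isGreatest_Icc one_le_two) (isLeast_Icc hu)
  rwa [Set.Icc_union_Icc_eq_Icc one_le_two hu] at this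

theorem decayGap_pos (h : IsDickman ρ) {u : ℝ} (hu : 2 ≤ u) : 0 < decayGap ρ u := by
  refine pos_of_forall_lt_pos h.continuousOn_decayGap (fun u hu hlt => ?_) hu
  have hw := h.strictMonoOn_decay_of_decayGap_pos hu hlt
  set c := decay ρ (u - 1) with hc
  have hmono : StrictMonoOn (fun t => -ρ t - c * primitive ρ t) (Set.Icc (u - 1) u) := by
    have hsub : Set.Icc (u - 1) u ⊆ Set.Ici 0 := fun x hx => by
      simp only [Set.mem_Ici]; linarith [hx.1]
    refine strictMonoOn_of_deriv_pos (convex_Icc _ _) ((h.continuousOn.mono hsub).neg.sub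
      (continuousOn_const.mul (h.continuousOn_primitive.mono hsub))) fun x hx => ?_
    rw [interior_Icc] at hx
    have hd := (h.hasDerivAt' (t := x) (by linarith [hx.1])).neg.sub
      ((h.hasDerivAt_primitive (t := x) (by linarith [hx.1])).const_mul c)
    have hd' : deriv (fun t => -ρ t - c * primitive ρ t) x = - -(decay ρ x * ρ x) - c * ρ x :=
      hd.deriv
    rw [hd', neg_neg, ← sub_mul]
    refine mul_pos (sub_pos.2 (hw ⟨by linarith, by linarith⟩ ⟨by linarith [hx.1], hx.2.le⟩ hx.1))
      (h.pos (by linarith [hx.1]))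
  have := hmono (Set.left_mem_Icc.2 (by linarith)) (Set.right_mem_Icc.2 (by linarith))
    (by linarith : u - 1 < u)
  rw [decayGap, h.mul_eq_primitive_sub (by linarith), ← hc]
  linarith

theorem monotoneOn_decay (h : IsDickman ρ) : MonotoneOn (decay ρ) (Set.Ici 1) := by
  intro a ha b hb hab
  exact (h.strictMonoOn_decay_of_decayGap_pos (u := max 2 b) (le_max_left _ _)
    fun t ht _ => h.decayGap_pos ht).monotoneOn ⟨ha, hab.trans (le_max_right _ _)⟩
    ⟨hb, le_max_right _ _⟩ hab

theorem hasDerivAt_mul_exp (h : IsDickman ρ) (c : ℝ) {t : ℝ} (ht : 1 < t) :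
    HasDerivAt (fun x => ρ x * Real.exp (x * c)) ((c - decay ρ t) * (ρ t * Real.exp (t * c))) t := by
  have h1 : HasDerivAt (fun x : ℝ => Real.exp (x * c)) (Real.exp (t * c) * (1 * c)) t :=
    ((hasDerivAt_id t).mul_const c).exp
  exact ((h.hasDerivAt' ht).mul h1).congr_deriv (by ring)

theorem continuousOn_mul_exp (h : IsDickman ρ) (c : ℝ) :
    ContinuousOn (fun x => ρ x * Real.exp (x * c)) (Set.Ici 0) :=
  h.continuousOn.mul (by fun_prop)

theorem decay_le (h : IsDickman ρ) {u : ℝ} (hu : 1 ≤ u) : decay ρ u ≤ 4 * Real.log (u + 1) := by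
  set c := decay ρ u with hc
  have hanti : AntitoneOn (fun x => ρ x * Real.exp (x * c)) (Set.Ici u) := by
    refine antitoneOn_of_deriv_nonpos (convex_Ici u) ((h.continuousOn_mul_exp c).mono
      (Set.Ici_subset_Ici.2 (by linarith))) ?_ ?_
    all_goals
      intro x hx
      rw [interior_Ici] at hx
      have hx : u < x := hx
    · exact (h.hasDerivAt_mul_exp c (by linarith)).differentiableAt.differentiableWithinAt
    · rw [(h.hasDerivAt_mul_exp c (by linarith)).deriv]
      have h1 : c ≤ decay ρ x := h.monotoneOn_decay hu (hu.trans hx.le) hx.le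
      have h2 := h.pos (t := x) (by linarith)
      exact mul_nonpos_of_nonpos_of_nonneg (by linarith) (by positivity)
  have h1 := hanti (a := u + 1 / 2) (b := u + 1) (by simp) (by simp) (by linarith)
  simp only at h1
  have h2 : ρ (u + 1) * Real.exp (c / 2) ≤ ρ (u + 1 / 2) := by
    rw [show (u + 1) * c = c / 2 + (u + 1 / 2) * c by ring, Real.exp_add, ← mul_assoc] at h1
    exact le_of_mul_le_mul_right h1 (Real.exp_pos _)
  have h3 := h.mul_eq_primitive_sub (t := u + 1) (by linarith)
  rw [add_sub_cancel_right] at h3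
  have h4 := h.sub_mul_le_primitive_sub (a := u) (b := u + 1 / 2) (by linarith) (by linarith)
  have h5 := h.sub_mul_le_primitive_sub (a := u + 1 / 2) (b := u + 1) (by linarith) (by linarith)
  have hp := h.pos (t := u + 1) (by linarith)
  have h6 : ρ (u + 1) * Real.exp (c / 2) ≤ ρ (u + 1) * (2 * (u + 1)) := by linarith
  have h7 : Real.exp (c / 2) ≤ (u + 1) ^ 2 := by
    have := le_of_mul_le_mul_left h6 hp
    nlinarith
  have h8 := (Real.le_log_iff_exp_le (by positivity)).2 h7
  rw [Real.log_pow] at h8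
  push_cast at h8
  linarith

theorem mul_exp_le (h : IsDickman ρ) {a b u : ℝ} (hu : 1 ≤ u) (ha : 0 ≤ a) (hab : a ≤ b)
    (hbu : b ≤ u) : ρ a * Real.exp (-((b - a) * (4 * Real.log (u + 1)))) ≤ ρ b := by
  set c := 4 * Real.log (u + 1) with hc
  have hc0 : 0 ≤ c := mul_nonneg (by norm_num) (Real.log_nonneg (by linarith))
  have h1 : MonotoneOn (fun x => ρ x * Real.exp (x * c)) (Set.Icc 0 1) := by
    intro x hx y hy hxy
    simp only [h.eq_one x hx.1 hx.2, h.eq_one y hy.1 hy.2, one_mul]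
    exact Real.exp_le_exp.2 (mul_le_mul_of_nonneg_right hxy hc0)
  have h2 : MonotoneOn (fun x => ρ x * Real.exp (x * c)) (Set.Icc 1 u) := by
    refine monotoneOn_of_deriv_nonneg (convex_Icc 1 u) ((h.continuousOn_mul_exp c).mono
      fun x hx => zero_le_one.trans hx.1) ?_ ?_
    all_goals
      intro x hx
      rw [interior_Icc] at hx
    · exact (h.hasDerivAt_mul_exp c hx.1).differentiableAt.differentiableWithinAt
    · rw [(h.hasDerivAt_mul_exp c hx.1).deriv]
      have h3 : decay ρ x ≤ c := (h.monotoneOn_decay hx.1.le hu hx.2.le).trans (h.decay_le hu)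
      have h4 := h.pos (t := x) (by linarith [hx.1])
      exact mul_nonneg (by linarith) (by positivity)
  have h3 := h1.union_right h2 (isGreatest_Icc zero_le_one) (isLeast_Icc hu)
  rw [Set.Icc_union_Icc_eq_Icc zero_le_one hu] at h3
  have h4 := h3 ⟨ha, hab.trans hbu⟩ ⟨ha.trans hab, hbu⟩ hab
  simp only at h4
  rw [show -((b - a) * c) = a * c - b * c by ring, Real.exp_sub, ← mul_div_assoc,
    div_le_iff₀ (Real.exp_pos _)]
  exact h4

theorem exp_le (h : IsDickman ρ) {u : ℝ} (hu : 1 ≤ u) :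
    Real.exp (-(u * (4 * Real.log (u + 1)))) ≤ ρ u := by
  have := h.mul_exp_le hu le_rfl (by linarith : (0 : ℝ) ≤ u) le_rfl
  rwa [h.eq_one 0 le_rfl zero_le_one, one_mul, sub_zero] at this

end IsDickman

theorem mul_smoothProportion_of_le {n r : ℕ} (h : r ≤ n) :
    (n : ℝ) * smoothProportion r n
      = ∑ i ∈ Finset.range r, smoothProportion r (n - (i + 1)) := by
  rw [mul_smoothProportion, min_eq_left h, Finset.range_eq_Ico,
    Finset.sum_Ico_add' (fun k => smoothProportion r (n - k)) 0 r 1]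
  rfl

namespace IsDickman

variable {ρ : ℝ → ℝ}

theorem mul_le_sum (h : IsDickman ρ) {n r : ℕ} (hr : 0 < r) (hrn : r ≤ n) :
    n * ρ (n / r) ≤ ∑ i ∈ Finset.range r, ρ (((n - (i + 1) : ℕ) : ℝ) / r) := by
  have hr0 : (0 : ℝ) < r := by exact_mod_cast hr
  have hstep : ∀ i ∈ Finset.range r,
      r * (primitive ρ ((n - (i : ℕ)) / r) - primitive ρ ((n - ((i + 1 : ℕ) : ℝ)) / r))
        ≤ ρ (((n - (i + 1) : ℕ) : ℝ) / r) := by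
    intro i hi
    have hin : i + 1 ≤ n := (Nat.succ_le_iff.2 (Finset.mem_range.1 hi)).trans hrn
    rw [Nat.cast_sub hin]
    have hin' : ((i + 1 : ℕ) : ℝ) ≤ n := by exact_mod_cast hin
    have h1 := h.primitive_sub_le_sub_mul (a := (n - ((i + 1 : ℕ) : ℝ)) / r)
      (b := (n - (i : ℕ)) / r) (div_nonneg (by linarith) hr0.le)
      (div_le_div_of_nonneg_right (by push_cast; linarith) hr0.le)
    refine (mul_le_mul_of_nonneg_left h1 hr0.le).trans (le_of_eq ?_)
    push_cast
    field_simp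
    ring
  have h1 := Finset.sum_le_sum hstep
  rw [← Finset.mul_sum, Finset.sum_range_sub' (fun i : ℕ => primitive ρ ((n - (i : ℝ)) / r))] at h1
  have h2 := h.mul_eq_primitive_sub (t := n / r) ((one_le_div hr0).2 (by exact_mod_cast hrn))
  have h3 : (n - (r : ℝ)) / r = n / r - 1 := by field_simp
  rw [h3, Nat.cast_zero, sub_zero, ← h2] at h1
  refine le_trans (le_of_eq ?_) h1
  field_simp

theorem sum_le_mul_add (h : IsDickman ρ) {n r : ℕ} (hr : 0 < r) (hrn : r ≤ n) :
    ∑ i ∈ Finset.range r, ρ (((n - (i + 1) : ℕ) : ℝ) / r) ≤ n * ρ (n / r) + ρ (n / r - 1) := by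
  have hr0 : (0 : ℝ) < r := by exact_mod_cast hr
  set g : ℕ → ℝ := fun i => r * primitive ρ ((n - (i : ℝ)) / r) - ρ ((n - (i : ℝ)) / r) with hg
  have hstep : ∀ i ∈ Finset.range r, ρ (((n - (i + 1) : ℕ) : ℝ) / r) ≤ g i - g (i + 1) := by
    intro i hi
    have hin : i + 1 ≤ n := (Nat.succ_le_iff.2 (Finset.mem_range.1 hi)).trans hrn
    rw [Nat.cast_sub hin]
    have hin' : ((i + 1 : ℕ) : ℝ) ≤ n := by exact_mod_cast hin
    have h1 := h.sub_mul_le_primitive_sub (a := (n - ((i + 1 : ℕ) : ℝ)) / r)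
      (b := (n - (i : ℕ)) / r) (div_nonneg (by linarith) hr0.le)
      (div_le_div_of_nonneg_right (by push_cast; linarith) hr0.le)
    have h2 := mul_le_mul_of_nonneg_left h1 hr0.le
    have h3 : r * (((n - (i : ℝ)) / r - (n - ((i + 1 : ℕ) : ℝ)) / r) * ρ ((n - (i : ℝ)) / r))
        = ρ ((n - (i : ℝ)) / r) := by push_cast; field_simp; ring
    rw [h3] at h2
    simp only [hg]
    linarith
  have h1 := Finset.sum_le_sum hstep
  rw [Finset.sum_range_sub'] at h1
  have hv : (1 : ℝ) ≤ n / r := (one_le_div hr0).2 (by exact_mod_cast hrn)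
  have h2 := h.mul_eq_primitive_sub hv
  have h3 : (n - (r : ℝ)) / r = n / r - 1 := by field_simp
  have h4 : (n : ℝ) * ρ (n / r) = r * (n / r * ρ (n / r)) := by field_simp
  simp only [hg, h3, Nat.cast_zero, sub_zero] at h1
  rw [h4, h2]
  linarith [h.pos (zero_le_one.trans hv)]

theorem le_smoothProportion (h : IsDickman ρ) {r : ℕ} (hr : 0 < r) (n : ℕ) :
    ρ (n / r) ≤ smoothProportion r n := by
  induction n using Nat.strong_induction_on with
  | _ n ih =>
    rcases le_or_gt n r with hn | hn
    · rw [smoothProportion_of_le hn]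
      exact h.le_one (by positivity)
    · have hn0 : (0 : ℝ) < n := by exact_mod_cast hr.trans hn
      refine le_of_mul_le_mul_left ?_ hn0
      rw [mul_smoothProportion_of_le hn.le]
      exact (h.mul_le_sum hr hn.le).trans (Finset.sum_le_sum fun i _ => ih _ (by omega))

end IsDickman

theorem half_le_one_sub_exp_neg {x : ℝ} (h0 : 0 ≤ x) (h1 : x ≤ 1) :
    x / 2 ≤ 1 - Real.exp (-x) := by
  have h2 : Real.exp (-x) ≤ 1 / (1 + x) := by
    rw [Real.exp_neg, ← one_div]
    exact one_div_le_one_div_of_le (by linarith) (by linarith [Real.add_one_le_exp x])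
  have h3 : 1 / (1 + x) ≤ 1 - x / 2 := by
    rw [div_le_iff₀ (by linarith)]
    nlinarith
  linarith

namespace IsDickman

variable {ρ : ℝ → ℝ}

/-- The exponential weight `exp (-η k)` saves more than the boundary term `ρ (m / r - 1)` in the
comparison of the sum with the integral. -/
theorem le_sum_mul_one_sub_exp (h : IsDickman ρ) {m r : ℕ} (hr : 2 ≤ r) (hrm : r ≤ m) {L η : ℝ}
    (hL : Real.log (m / r + 1) ≤ L) (hη : 48 * L / r ^ 2 ≤ η) (hη1 : η * (r / 2) ≤ 1) :
    ρ (m / r - 1)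
      ≤ ∑ i ∈ Finset.range r, ρ (((m - (i + 1) : ℕ) : ℝ) / r) * (1 - Real.exp (-(η * (i + 1)))) := by
  have hr2 : (2 : ℝ) ≤ r := by exact_mod_cast hr
  have hr0 : (0 : ℝ) < r := by linarith
  have hv : (1 : ℝ) ≤ m / r := (one_le_div hr0).2 (by exact_mod_cast hrm)
  have hL2 : 1 / 2 ≤ L := by
    have := Real.log_le_log two_pos (by linarith : (2 : ℝ) ≤ m / r + 1)
    linarith [Real.log_two_gt_d9]
  have hη0 : 0 ≤ η := le_trans (by positivity) hη
  set J := ⌊r / (4 * L)⌋₊ with hJ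
  have hJle : (J : ℝ) ≤ r / (4 * L) := Nat.floor_le (by positivity)
  have hJlt : r / (4 * L) < J + 1 := Nat.lt_floor_add_one _
  have hJr : (J : ℝ) ≤ r / 2 :=
    hJle.trans (div_le_div_of_nonneg_left hr0.le two_pos (by linarith))
  have hJr' : J + 1 ≤ r := by
    have : ((J + 1 : ℕ) : ℝ) ≤ r := by push_cast; linarith
    exact_mod_cast this
  have hp := h.pos (t := m / r - 1) (by linarith)
  rw [← Finset.sum_range_reflect]
  have hterm : ∀ j ∈ Finset.range (J + 1), ρ (m / r - 1) * (Real.exp (-1) * (η * (r / 2) / 2))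
      ≤ ρ (((m - ((r - 1 - j) + 1) : ℕ) : ℝ) / r)
        * (1 - Real.exp (-(η * (((r - 1 - j : ℕ) : ℝ) + 1)))) := by
    intro j hj
    have hjJ : j ≤ J := Nat.lt_succ_iff.1 (Finset.mem_range.1 hj)
    have hjJ' : (j : ℝ) ≤ J := by exact_mod_cast hjJ
    have e1 : (((m - ((r - 1 - j) + 1) : ℕ) : ℝ)) = m - r + j := by
      rw [show m - ((r - 1 - j) + 1) = m - r + j by omega, Nat.cast_add, Nat.cast_sub hrm]
    have e2 : ((r - 1 - j : ℕ) : ℝ) + 1 = r - j := by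
      rw [← Nat.cast_add_one, show r - 1 - j + 1 = r - j by omega, Nat.cast_sub (by omega)]
    rw [e1, e2, mul_comm (Real.exp (-1)), mul_comm (η * (r / 2) / 2), ← mul_assoc]
    have hjr : (j : ℝ) / r ≤ 1 := (div_le_one hr0).2 (by linarith)
    have e3 : ((m : ℝ) - r + j) / r = m / r - 1 + j / r := by field_simp
    have h1 := h.mul_exp_le hv (a := m / r - 1) (b := ((m : ℝ) - r + j) / r) (by linarith)
      (by rw [e3]; linarith [div_nonneg j.cast_nonneg hr0.le]) (by rw [e3]; linarith)
    have h2 : Real.exp (-1)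
        ≤ Real.exp (-((((m : ℝ) - r + j) / r - (m / r - 1)) * (4 * Real.log (m / r + 1)))) := by
      refine Real.exp_le_exp.2 (neg_le_neg ?_)
      rw [e3, add_sub_cancel_left]
      calc (j : ℝ) / r * (4 * Real.log (m / r + 1)) ≤ (r / (4 * L)) / r * (4 * L) := by
            have := hjJ'.trans hJle
            gcongr
            exact mul_nonneg (by norm_num) (Real.log_nonneg (by linarith))
        _ = 1 := by field_simp
    have h3 : η * (r / 2) / 2 ≤ 1 - Real.exp (-(η * (r - j))) := by
      refine (half_le_one_sub_exp_neg (by positivity) hη1).trans (sub_le_sub_left ?_ _)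
      refine Real.exp_le_exp.2 (neg_le_neg (mul_le_mul_of_nonneg_left ?_ hη0))
      linarith
    have h4 := (mul_le_mul_of_nonneg_left h2 hp.le).trans h1
    exact mul_le_mul h4 h3 (by positivity) (h4.trans' (by positivity))
  have hsum := Finset.sum_le_sum hterm
  rw [Finset.sum_const, Finset.card_range, nsmul_eq_mul] at hsum
  have hsub := Finset.sum_le_sum_of_subset_of_nonneg (Finset.range_mono hJr')
    (f := fun j => ρ (((m - ((r - 1 - j) + 1) : ℕ) : ℝ) / r)
        * (1 - Real.exp (-(η * (((r - 1 - j : ℕ) : ℝ) + 1)))))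
    fun j _ _ => mul_nonneg (h.pos (by positivity)).le
      (sub_nonneg.2 (Real.exp_le_one_iff.2 (neg_nonpos.2 (by positivity))))
  refine le_trans ?_ (hsum.trans hsub)
  have he : (1 : ℝ) / 3 ≤ Real.exp (-1) := by
    rw [Real.exp_neg, ← one_div]
    exact one_div_le_one_div_of_le (Real.exp_pos 1) (by linarith [Real.exp_one_lt_d9])
  have hone : 1 ≤ ((J + 1 : ℕ) : ℝ) * (Real.exp (-1) * (η * (r / 2) / 2)) := by
    calc (1 : ℝ) = r / (4 * L) * (1 / 3 * (48 * L / r ^ 2 * (r / 2) / 2)) := by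
          field_simp
          norm_num
      _ ≤ _ := by
          push_cast
          gcongr
  calc ρ (m / r - 1) = ρ (m / r - 1) * 1 := (mul_one _).symm
    _ ≤ ρ (m / r - 1) * (((J + 1 : ℕ) : ℝ) * (Real.exp (-1) * (η * (r / 2) / 2))) :=
        mul_le_mul_of_nonneg_left hone hp.le
    _ = _ := by ring

theorem smoothProportion_le (h : IsDickman ρ) {n r : ℕ} (hr : 2 ≤ r) {η : ℝ}
    (hη : 48 * Real.log (n / r + 1) / r ^ 2 ≤ η) (hη1 : η * (r / 2) ≤ 1) {m : ℕ} (hmn : m ≤ n) :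
    smoothProportion r m ≤ ρ (m / r) * Real.exp (η * m) := by
  have hr0 : (0 : ℝ) < r := by exact_mod_cast two_pos.trans_le hr
  have hη0 : 0 ≤ η := by
    have : 0 ≤ Real.log ((n : ℝ) / r + 1) := Real.log_nonneg (by simp; positivity)
    exact le_trans (by positivity) hη
  induction m using Nat.strong_induction_on with
  | _ m ih =>
    rcases le_or_gt m r with hm | hm
    · rw [smoothProportion_of_le hm, h.eq_one _ (by positivity)
        ((div_le_one hr0).2 (by exact_mod_cast hm)), one_mul]
      exact Real.one_le_exp (by positivity)
    · have hm0 : (0 : ℝ) < m := hr0.trans (by exact_mod_cast hm)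
      refine le_of_mul_le_mul_left ?_ hm0
      rw [mul_smoothProportion_of_le hm.le]
      have hlog : Real.log ((m : ℝ) / r + 1) ≤ Real.log (n / r + 1) :=
        Real.log_le_log (by positivity) (by gcongr)
      have h1 := h.le_sum_mul_one_sub_exp hr hm.le hlog hη hη1
      have h2 := h.sum_le_mul_add (two_pos.trans_le hr) hm.le
      have h3 : ∀ i ∈ Finset.range r, smoothProportion r (m - (i + 1))
          ≤ Real.exp (η * m) * (ρ (((m - (i + 1) : ℕ) : ℝ) / r)
            - ρ (((m - (i + 1) : ℕ) : ℝ) / r) * (1 - Real.exp (-(η * (i + 1))))) := by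
        intro i hi
        have him : i + 1 ≤ m := (Nat.succ_le_iff.2 (Finset.mem_range.1 hi)).trans hm.le
        refine (ih _ (by omega) (by omega)).trans (le_of_eq ?_)
        rw [show η * ((m - (i + 1) : ℕ) : ℝ) = η * m + -(η * (i + 1)) by
          rw [Nat.cast_sub him]; push_cast; ring, Real.exp_add]
        ring
      refine (Finset.sum_le_sum h3).trans ?_
      rw [← Finset.mul_sum, Finset.sum_sub_distrib]
      calc _ ≤ Real.exp (η * m) * (m * ρ (m / r)) :=
            mul_le_mul_of_nonneg_left (by linarith) (Real.exp_pos _).le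
        _ = _ := by ring

end IsDickman

theorem three_le_of_sqrt_mul_log_le {n r : ℕ} (hr : 0 < r) (hrn : r < n)
    (h : Real.sqrt (n * Real.log n) ≤ r) : 3 ≤ n := by
  by_contra hn
  obtain rfl : n = 2 := by omega
  obtain rfl : r = 1 := by omega
  have := (Real.sqrt_le_iff.1 h).2
  norm_num at this
  linarith [Real.log_two_gt_d9]

theorem log_div_add_one_bounds {n r : ℕ} (hn : 3 ≤ n) (hr : 0 < r)
    (h : Real.sqrt (n * Real.log n) ≤ r) :
    (n : ℝ) ≤ r ^ 2 ∧ Real.log (n / r + 1) ≤ 2 * Real.sqrt r ∧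
      Real.log (n / r + 1) * n ≤ 2 * r ^ 2 := by
  have hr0 : (1 : ℝ) ≤ r := by exact_mod_cast hr
  have hn3 : (3 : ℝ) ≤ n := by exact_mod_cast hn
  have hsq := (Real.sqrt_le_iff.1 h).2
  have hlog : 1 ≤ Real.log n :=
    (Real.le_log_iff_exp_le (by linarith)).2 (by linarith [Real.exp_one_lt_d9])
  have h1 : (n : ℝ) ≤ r ^ 2 := by nlinarith
  have hu : (n : ℝ) / r ≤ r := (div_le_iff₀ (by linarith)).2 (by linarith)
  have hun : (n : ℝ) / r ≤ n := div_le_self (by linarith) hr0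
  refine ⟨h1, ?_, ?_⟩
  · have hs := Real.sq_sqrt (by linarith : (0 : ℝ) ≤ r)
    have hs0 := Real.sqrt_nonneg (r : ℝ)
    calc Real.log (n / r + 1) ≤ Real.log ((Real.sqrt r + 1) ^ 2) :=
          Real.log_le_log (by positivity) (by nlinarith)
      _ = 2 * Real.log (Real.sqrt r + 1) := by rw [Real.log_pow]; norm_num
      _ ≤ 2 * Real.sqrt r := by
          linarith [Real.log_le_sub_one_of_pos (by positivity : 0 < Real.sqrt r + 1)]
  · have h2 : Real.log (n / r + 1) ≤ 2 * Real.log n := by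
      calc Real.log (n / r + 1) ≤ Real.log ((n : ℝ) ^ 2) :=
            Real.log_le_log (by positivity) (by nlinarith)
        _ = 2 * Real.log n := by rw [Real.log_pow]; norm_num
    nlinarith

theorem IsDickman.abs_sub_le_of_large {ρ : ℝ → ℝ} (h : IsDickman ρ) {n r : ℕ} (hn : 3 ≤ n)
    (hr : 2304 ≤ r) (hs : Real.sqrt (n * Real.log n) ≤ r) :
    |smoothProportion r n - ρ (n / r)|
      ≤ 48 * Real.exp 96 * ρ (n / r) * (n / r * Real.log (n / r + 1)) / r := by
  obtain ⟨-, hlog, hprod⟩ := log_div_add_one_bounds hn (by omega) hs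
  have hr0 : (2304 : ℝ) ≤ r := by exact_mod_cast hr
  have hL0 : 0 ≤ Real.log ((n : ℝ) / r + 1) := Real.log_nonneg (by simp; positivity)
  set L := Real.log ((n : ℝ) / r + 1) with hL
  set η := 48 * L / (r : ℝ) ^ 2 with hη
  have hs48 : 48 ≤ Real.sqrt r := Real.le_sqrt_of_sq_le (by linarith)
  have hη1 : η * (r / 2) ≤ 1 := by
    have : η * (r / 2) = 24 * L / r := by rw [hη]; field_simp; ring
    rw [this, div_le_one (by linarith)]
    nlinarith [Real.sq_sqrt (by linarith : (0 : ℝ) ≤ r)]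
  have hup := h.smoothProportion_le (n := n) (by omega) hη.ge hη1 le_rfl
  have hlo := h.le_smoothProportion (r := r) (by omega) n
  have hp := h.pos (t := n / r) (by positivity)
  rw [abs_of_nonneg (by linarith)]
  set x := η * n with hx
  have hx0 : 0 ≤ x := by positivity
  have hx96 : x ≤ 96 := by
    have : x = 48 * (L * n) / r ^ 2 := by rw [hx, hη]; ring
    rw [this, div_le_iff₀ (by positivity)]
    linarith
  have hexp : Real.exp x - 1 ≤ x * Real.exp 96 := by
    have h1 : Real.exp x * (1 - x) ≤ 1 := by
      calc Real.exp x * (1 - x) ≤ Real.exp x * Real.exp (-x) :=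
            mul_le_mul_of_nonneg_left (by linarith [Real.add_one_le_exp (-x)]) (Real.exp_pos x).le
        _ = 1 := by rw [← Real.exp_add, add_neg_cancel, Real.exp_zero]
    have h2 := mul_le_mul_of_nonneg_left (Real.exp_le_exp.2 hx96) hx0
    linarith
  calc _ ≤ ρ (n / r) * (Real.exp x - 1) := by linarith
    _ ≤ ρ (n / r) * (x * Real.exp 96) := mul_le_mul_of_nonneg_left hexp hp.le
    _ = _ := by
      rw [hx, hη]
      field_simp

theorem IsDickman.abs_sub_le_of_small {ρ : ℝ → ℝ} (h : IsDickman ρ) {n r R : ℕ} (hn : 3 ≤ n)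
    (hr : 0 < r) (hrR : r ≤ R) (hrn : r < n) (hs : Real.sqrt (n * Real.log n) ≤ r) :
    |smoothProportion r n - ρ (n / r)|
      ≤ 2 * R * Real.exp ((R : ℝ) ^ 2 * (4 * Real.log ((R : ℝ) ^ 2 + 1))) * ρ (n / r)
        * (n / r * Real.log (n / r + 1)) / r := by
  obtain ⟨hnr, -, -⟩ := log_div_add_one_bounds hn hr hs
  have hr0 : (1 : ℝ) ≤ r := by exact_mod_cast hr
  have hrR' : (r : ℝ) ≤ R := by exact_mod_cast hrR
  have hlo := h.le_smoothProportion hr n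
  set u := (n : ℝ) / r with hu
  have hu1 : 1 ≤ u := (one_le_div (by linarith)).2 (by exact_mod_cast hrn.le)
  have huR : u ≤ (R : ℝ) ^ 2 := by
    have : u ≤ n := div_le_self (by positivity) hr0
    nlinarith
  have hp := h.pos (t := u) (by linarith)
  have hν : smoothProportion r n ≤ 1 := by
    rw [smoothProportion, div_le_one (by positivity)]
    have := Finset.card_le_univ (Snr n r)
    rw [Fintype.card_perm, Fintype.card_fin] at this
    exact_mod_cast this
  rw [abs_of_nonneg (by linarith)]
  set E := (R : ℝ) ^ 2 * (4 * Real.log ((R : ℝ) ^ 2 + 1)) with hE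
  have hlogu : 1 / 2 ≤ Real.log (u + 1) := by
    have := Real.log_le_log two_pos (by linarith : (2 : ℝ) ≤ u + 1)
    linarith [Real.log_two_gt_d9]
  have hρ : 1 ≤ Real.exp E * ρ u := by
    have h1 : Real.exp (-E) ≤ ρ u := by
      refine le_trans (Real.exp_le_exp.2 (neg_le_neg ?_)) (h.exp_le hu1)
      rw [hE]
      gcongr
    calc 1 = Real.exp E * Real.exp (-E) := by rw [← Real.exp_add, add_neg_cancel, Real.exp_zero]
      _ ≤ _ := mul_le_mul_of_nonneg_left h1 (Real.exp_pos E).le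
  have hul : 1 / 2 ≤ u * Real.log (u + 1) := by nlinarith
  rw [le_div_iff₀ (by linarith)]
  calc (smoothProportion r n - ρ u) * r ≤ 1 * r := by
        gcongr
        linarith
    _ ≤ R := by linarith
    _ = 2 * R * 1 * (1 / 2) := by ring
    _ ≤ 2 * R * (Real.exp E * ρ u) * (u * Real.log (u + 1)) := by gcongr
    _ = _ := by ring

/-- `ν(n,r) = |S_n^r|/n! = ρ(u)(1 + O(u log(u+1)/r))` for `√(n log n) ≤ r ≤ n`, `u = n/r`,
where `ρ` is the Dickman function. -/
theorem stmt1 :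
    ∃ C > (0:ℝ), ∀ ρ : ℝ → ℝ,
      (∀ t : ℝ, 0 ≤ t → t ≤ 1 → ρ t = 1) →
      ContinuousOn ρ (Set.Ici 0) →
      (∀ t : ℝ, 1 < t → HasDerivAt ρ (-ρ (t - 1) / t) t) →
      ∀ n r : ℕ, 0 < r → Real.sqrt ((n:ℝ) * Real.log n) ≤ (r:ℝ) → r ≤ n →
        |((Snr n r).card : ℝ) / (Nat.factorial n : ℝ) - ρ ((n:ℝ) / r)|
          ≤ C * ρ ((n:ℝ) / r) * (((n:ℝ) / r) * Real.log ((n:ℝ) / r + 1)) / r := by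
  set C₁ : ℝ := 48 * Real.exp 96
  set C₂ : ℝ := 2 * (2304 : ℕ) *
    Real.exp (((2304 : ℕ) : ℝ) ^ 2 * (4 * Real.log (((2304 : ℕ) : ℝ) ^ 2 + 1)))
  have hC₁ : 0 < C₁ := by positivity
  have hC₂ : 0 < C₂ := by positivity
  refine ⟨C₁ + C₂, by positivity, fun ρ h1 h2 h3 n r hr hs hrn => ?_⟩
  have h : IsDickman ρ := ⟨h1, h2, h3⟩
  have hr0 : (0 : ℝ) < r := by exact_mod_cast hr
  have hp := h.pos (t := n / r) (by positivity)
  have hL0 : 0 ≤ Real.log ((n : ℝ) / r + 1) := Real.log_nonneg (by simp; positivity)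
  change |smoothProportion r n - ρ (n / r)| ≤ _
  rcases hrn.eq_or_lt with rfl | hlt
  · rw [smoothProportion_of_le le_rfl, div_self hr0.ne', h1 1 zero_le_one le_rfl, sub_self, abs_zero]
    have : 0 ≤ Real.log ((1 : ℝ) + 1) := Real.log_nonneg (by norm_num)
    positivity
  have hn := three_le_of_sqrt_mul_log_le hr hlt hs
  rcases le_total 2304 r with hR | hR
  · refine (h.abs_sub_le_of_large hn hR hs).trans ?_
    gcongr
    exact le_add_of_nonneg_right hC₂.le
  · refine (h.abs_sub_le_of_small hn hr hR hlt hs).trans ?_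
    gcongr
    exact le_add_of_nonneg_left hC₁.le
end

section
/- Let n, r, d, k be positive integers with 1 \le k \le d \le r \le n and n \ge 2. Let \sigma \in S_n^r be fixed, let \tau be a uniformly random transposition of {1,...,n}, and set \sigma' = \tau\circ\sigma if \tau\circ\sigma \in S_n^r and \sigma' = \sigma otherwise. Let A_k be the event \{W_k(\sigma') = W_k(\sigma) + 1 and W_j(\sigma') = W_j(\sigma) for all k+1 \le j \le d\}. Then P[A_k] = (2/(n(n-1))) \sum_{a=1}^{n} ( 1\{L(C_a) > d + k\} + 1\{d < L(C_a) < 2k\} ) + (1/(n(n-1))) \sum_{a=1}^{n} \sum_{b \ne a} 1\{b is not in the cycle of \sigma containing a\} \cdot 1\{L(C_a) + L(C_b) = k\}, where all cycle quantities refer to \sigma. -/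
open scoped Classical

open Equiv Function

lemma cycLen_eq_minimalPeriod {n : ℕ} (σ : Perm (Fin n)) (a : Fin n) :
    cycLen σ a = minimalPeriod σ a := by
  have h : Finset.univ.filter (fun b => σ.SameCycle a b)
      = (Finset.range (minimalPeriod σ a)).image (fun m => σ^[m] a) := by
    ext b
    simp only [Finset.mem_filter, Finset.mem_univ, true_and, Finset.mem_image, Finset.mem_range]
    constructor
    · intro hb
      obtain ⟨m, -, -, rfl⟩ := hb.exists_pow_eq'
      refine ⟨m % minimalPeriod σ a, Nat.mod_lt _ ?_, ?_⟩
      · exact minimalPeriod_pos_of_mem_periodicPts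
          (mem_periodicPts.2 ⟨orderOf σ, orderOf_pos σ, by
            simp [IsPeriodicPt, IsFixedPt, Perm.iterate_eq_pow, pow_orderOf_eq_one]⟩)
      · rw [iterate_mod_minimalPeriod_eq, Perm.iterate_eq_pow]
    · rintro ⟨m, -, rfl⟩
      exact ⟨m, by simp [Perm.iterate_eq_pow]⟩
  rw [cycLen, h, Finset.card_image_of_injOn, Finset.card_range]
  intro x hx y hy hxy
  exact iterate_injOn_Iio_minimalPeriod (by simpa using hx) (by simpa using hy) hxy

lemma cycLen_pos {n : ℕ} (σ : Perm (Fin n)) (a : Fin n) : 0 < cycLen σ a :=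
  Finset.card_pos.2 ⟨a, by simp [Perm.SameCycle.refl]⟩

lemma pow_cycLen_apply {n : ℕ} (σ : Perm (Fin n)) (a : Fin n) :
    (σ ^ cycLen σ a) a = a := by
  rw [cycLen_eq_minimalPeriod, ← Perm.iterate_eq_pow]
  exact iterate_minimalPeriod

lemma pow_apply_injOn {n : ℕ} (σ : Perm (Fin n)) (a : Fin n) {s t : ℕ}
    (hs : s < cycLen σ a) (ht : t < cycLen σ a) (h : (σ ^ s) a = (σ ^ t) a) : s = t := by
  rw [cycLen_eq_minimalPeriod] at hs ht
  rw [← Perm.iterate_eq_pow, ← Perm.iterate_eq_pow] at h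
  exact iterate_injOn_Iio_minimalPeriod hs ht h

lemma exists_pow_apply_eq {n : ℕ} {σ : Perm (Fin n)} {a b : Fin n} (h : σ.SameCycle a b) :
    ∃ m < cycLen σ a, (σ ^ m) a = b := by
  obtain ⟨m, -, -, rfl⟩ := h.exists_pow_eq'
  refine ⟨m % cycLen σ a, Nat.mod_lt _ (cycLen_pos σ a), ?_⟩
  rw [cycLen_eq_minimalPeriod, ← Perm.iterate_eq_pow, iterate_mod_minimalPeriod_eq,
    Perm.iterate_eq_pow]

lemma cycLen_eq_of_pow {n : ℕ} {σ : Perm (Fin n)} {a : Fin n} {i : ℕ} (hi : 0 < i)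
    (h : (σ ^ i) a = a) (hne : ∀ m, 0 < m → m < i → (σ ^ m) a ≠ a) : cycLen σ a = i := by
  have hle : cycLen σ a ≤ i := by
    rw [cycLen_eq_minimalPeriod]
    exact IsPeriodicPt.minimalPeriod_le hi (by
      simpa [IsPeriodicPt, IsFixedPt, Perm.iterate_eq_pow] using h)
  by_contra hlt
  exact hne _ (cycLen_pos σ a) (by omega) (pow_cycLen_apply σ a)

lemma cycLen_eq_of_sameCycle {n : ℕ} {σ : Perm (Fin n)} {a b : Fin n} (h : σ.SameCycle a b) :
    cycLen σ a = cycLen σ b := by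
  unfold cycLen
  congr 1
  ext c
  simp only [Finset.mem_filter, Finset.mem_univ, true_and]
  exact ⟨fun hc => h.symm.trans hc, fun hc => h.trans hc⟩

lemma sameCycle_pow {n : ℕ} (σ : Perm (Fin n)) (a : Fin n) (m : ℕ) :
    σ.SameCycle a ((σ ^ m) a) := ⟨m, by simp⟩

lemma swap_mul_pow_apply {n : ℕ} (σ : Perm (Fin n)) (a b x : Fin n) (t : ℕ)
    (h : ∀ m, 0 < m → m ≤ t → (σ ^ m) x ≠ a ∧ (σ ^ m) x ≠ b) :
    ((swap a b * σ) ^ t) x = (σ ^ t) x := by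
  induction t with
  | zero => simp
  | succ t ih =>
    have h1 := h (t + 1) (by omega) le_rfl
    rw [pow_succ', Perm.mul_apply, ih fun m h0 hm => h m h0 (by omega), Perm.mul_apply,
      ← Perm.mul_apply σ, ← pow_succ']
    exact swap_apply_of_ne_of_ne h1.1 h1.2

lemma swap_mul_pow_apply_left {n : ℕ} (σ : Perm (Fin n)) (a : Fin n) {i m : ℕ}
    (hi : i < cycLen σ a) (hm : m < i) :
    ((swap a ((σ ^ i) a) * σ) ^ m) a = (σ ^ m) a := by
  apply swap_mul_pow_apply
  intro s hs hsm
  constructor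
  · intro h
    have := pow_apply_injOn σ a (s := s) (t := 0) (by omega) (by omega) (by simpa using h)
    omega
  · intro h
    have := pow_apply_injOn σ a (s := s) (t := i) (by omega) (by omega) h
    omega

lemma cycLen_swap_mul_left {n : ℕ} (σ : Perm (Fin n)) (a : Fin n) {i : ℕ} (hi0 : 0 < i)
    (hi : i < cycLen σ a) : cycLen (swap a ((σ ^ i) a) * σ) a = i := by
  apply cycLen_eq_of_pow hi0
  · obtain ⟨t, rfl⟩ : ∃ t, i = t + 1 := ⟨i - 1, by omega⟩
    rw [pow_succ', Perm.mul_apply, swap_mul_pow_apply_left σ a hi (by omega), Perm.mul_apply,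
      ← Perm.mul_apply σ, ← pow_succ']
    exact swap_apply_right _ _
  · intro m h0 hm h
    rw [swap_mul_pow_apply_left σ a hi hm] at h
    have := pow_apply_injOn σ a (s := m) (t := 0) (by omega) (by omega) (by simpa using h)
    omega

lemma pow_sub_apply {n : ℕ} (σ : Perm (Fin n)) (a : Fin n) {i : ℕ} (hi : i ≤ cycLen σ a) :
    (σ ^ (cycLen σ a - i)) ((σ ^ i) a) = a := by
  rw [← Perm.mul_apply, ← pow_add, Nat.sub_add_cancel hi, pow_cycLen_apply]

lemma cycLen_swap_mul_right {n : ℕ} (σ : Perm (Fin n)) (a : Fin n) {i : ℕ} (hi0 : 0 < i)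
    (hi : i < cycLen σ a) :
    cycLen (swap a ((σ ^ i) a) * σ) ((σ ^ i) a) = cycLen σ a - i := by
  have hL : cycLen σ ((σ ^ i) a) = cycLen σ a :=
    (cycLen_eq_of_sameCycle (sameCycle_pow σ a i)).symm
  have := cycLen_swap_mul_left σ ((σ ^ i) a) (i := cycLen σ a - i) (by omega) (by omega)
  rwa [pow_sub_apply σ a hi.le, swap_comm] at this

lemma sameCycle_swap_mul_iff {n : ℕ} (σ : Perm (Fin n)) (a : Fin n) {i : ℕ} (hi0 : 0 < i)
    (hi : i < cycLen σ a) (x : Fin n) :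
    (swap a ((σ ^ i) a) * σ).SameCycle a x ↔ ∃ m < i, (σ ^ m) a = x := by
  constructor
  · intro h
    obtain ⟨m, hm, rfl⟩ := exists_pow_apply_eq h
    rw [cycLen_swap_mul_left σ a hi0 hi] at hm
    exact ⟨m, hm, (swap_mul_pow_apply_left σ a hi hm).symm⟩
  · rintro ⟨m, hm, rfl⟩
    rw [← swap_mul_pow_apply_left σ a hi hm]
    exact sameCycle_pow _ _ _

lemma sameCycle_swap_mul_right_iff {n : ℕ} (σ : Perm (Fin n)) (a : Fin n) {i : ℕ} (hi0 : 0 < i)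
    (hi : i < cycLen σ a) (x : Fin n) :
    (swap a ((σ ^ i) a) * σ).SameCycle ((σ ^ i) a) x ↔
      ∃ m, i ≤ m ∧ m < cycLen σ a ∧ (σ ^ m) a = x := by
  have hL : cycLen σ ((σ ^ i) a) = cycLen σ a :=
    (cycLen_eq_of_sameCycle (sameCycle_pow σ a i)).symm
  have h := sameCycle_swap_mul_iff σ ((σ ^ i) a) (i := cycLen σ a - i) (by omega) (by omega) x
  rw [pow_sub_apply σ a hi.le, swap_comm] at h
  rw [h]
  constructor
  · rintro ⟨m, hm, rfl⟩
    exact ⟨m + i, by omega, by omega, by rw [pow_add, Perm.mul_apply]⟩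
  · rintro ⟨m, h1, h2, rfl⟩
    exact ⟨m - i, by omega, by rw [← Perm.mul_apply, ← pow_add, Nat.sub_add_cancel h1]⟩

lemma cycLen_swap_mul_of_not_sameCycle {n : ℕ} (σ : Perm (Fin n)) {a b x : Fin n}
    (ha : ¬ σ.SameCycle a x) (hb : ¬ σ.SameCycle b x) :
    cycLen (swap a b * σ) x = cycLen σ x := by
  have h : ∀ t, ((swap a b * σ) ^ t) x = (σ ^ t) x := fun t =>
    swap_mul_pow_apply σ a b x t fun m _ _ =>
      ⟨fun h => ha (h ▸ sameCycle_pow σ x m).symm, fun h => hb (h ▸ sameCycle_pow σ x m).symm⟩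
  apply cycLen_eq_of_pow (cycLen_pos σ x)
  · rw [h, pow_cycLen_apply]
  · intro m h0 hm he
    rw [h] at he
    have := pow_apply_injOn σ x (s := m) (t := 0) hm (by omega) (by simpa using he)
    omega

lemma mul_cycleCount {n : ℕ} (σ : Perm (Fin n)) (j : ℕ) :
    j * cycleCount σ j = ∑ x, if cycLen σ x = j then 1 else 0 := by
  rw [← Finset.card_filter]
  apply Nat.mul_div_cancel'
  rw [Finset.card_eq_sum_card_image
    (fun a => Finset.univ.filter (fun b => σ.SameCycle a b))]
  apply Finset.dvd_sum
  intro s hs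
  obtain ⟨a, ha, rfl⟩ := Finset.mem_image.1 hs
  have ha' : cycLen σ a = j := by simpa using ha
  apply dvd_of_eq
  rw [← ha']
  nth_rewrite 1 [cycLen]
  congr 1
  ext b
  simp only [Finset.mem_filter, Finset.mem_univ, true_and]
  constructor
  · intro h
    refine ⟨(cycLen_eq_of_sameCycle h).symm, ?_⟩
    ext c
    simp only [Finset.mem_filter, Finset.mem_univ, true_and]
    exact ⟨fun hc => h.trans hc, fun hc => h.symm.trans hc⟩
  · rintro ⟨-, h⟩
    have : b ∈ Finset.univ.filter (fun c => σ.SameCycle b c) := by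
      simp [Perm.SameCycle.refl]
    rw [h] at this
    simpa using this

lemma sum_filter_sameCycle {n : ℕ} (σ : Perm (Fin n)) (a : Fin n) (j : ℕ) :
    (∑ x with σ.SameCycle a x, if cycLen σ x = j then 1 else 0)
      = if cycLen σ a = j then j else 0 := by
  rw [Finset.sum_congr rfl (g := fun _ => if cycLen σ a = j then 1 else 0)]
  · rw [Finset.sum_const]
    change cycLen σ a • _ = _
    split_ifs with h <;> simp [h]
  · intro x hx
    rw [cycLen_eq_of_sameCycle (Finset.mem_filter.1 hx).2]

/-- Multiplying by a transposition of two points of one cycle splits that cycle. -/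
lemma cycleCount_split {n : ℕ} (σ : Perm (Fin n)) (a : Fin n) {i : ℕ} (hi0 : 0 < i)
    (hi : i < cycLen σ a) {j : ℕ} (hj : 0 < j) :
    cycleCount (swap a ((σ ^ i) a) * σ) j + (if cycLen σ a = j then 1 else 0)
      = cycleCount σ j + (if i = j then 1 else 0) + (if cycLen σ a - i = j then 1 else 0) := by
  set ρ := swap a ((σ ^ i) a) * σ with hρ
  have hU : Finset.univ.filter (fun x => σ.SameCycle a x)
      = (Finset.univ.filter fun x => ρ.SameCycle a x) ∪
        Finset.univ.filter fun x => ρ.SameCycle ((σ ^ i) a) x := by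
    ext x
    simp only [Finset.mem_filter, Finset.mem_univ, true_and, Finset.mem_union, hρ,
      sameCycle_swap_mul_iff σ a hi0 hi, sameCycle_swap_mul_right_iff σ a hi0 hi]
    constructor
    · intro h
      obtain ⟨m, hm, rfl⟩ := exists_pow_apply_eq h
      by_cases h' : m < i
      · exact Or.inl ⟨m, h', rfl⟩
      · exact Or.inr ⟨m, by omega, hm, rfl⟩
    · rintro (⟨m, -, rfl⟩ | ⟨m, -, -, rfl⟩) <;> exact sameCycle_pow σ a m
  have hD : Disjoint (Finset.univ.filter fun x => ρ.SameCycle a x)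
      (Finset.univ.filter fun x => ρ.SameCycle ((σ ^ i) a) x) := by
    rw [Finset.disjoint_left]
    simp only [Finset.mem_filter, Finset.mem_univ, true_and, hρ,
      sameCycle_swap_mul_iff σ a hi0 hi, sameCycle_swap_mul_right_iff σ a hi0 hi]
    rintro x ⟨m, hm, rfl⟩ ⟨m', h1, h2, h⟩
    have := pow_apply_injOn σ a h2 (by omega) h
    omega
  have hout : (∑ x with ¬ σ.SameCycle a x, if cycLen ρ x = j then 1 else 0)
      = ∑ x with ¬ σ.SameCycle a x, if cycLen σ x = j then 1 else 0 := by
    refine Finset.sum_congr rfl fun x hx => ?_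
    have hx := (Finset.mem_filter.1 hx).2
    rw [hρ, cycLen_swap_mul_of_not_sameCycle σ hx
      fun h => hx ((sameCycle_pow σ a i).trans h)]
  have h1 := mul_cycleCount ρ j
  have h2 := mul_cycleCount σ j
  rw [← Finset.sum_filter_add_sum_filter_not _ (fun x => σ.SameCycle a x)] at h1 h2
  rw [hout, hU, Finset.sum_union hD, sum_filter_sameCycle, sum_filter_sameCycle,
    hρ, cycLen_swap_mul_left σ a hi0 hi, cycLen_swap_mul_right σ a hi0 hi, ← hρ] at h1
  rw [sum_filter_sameCycle] at h2
  apply Nat.eq_of_mul_eq_mul_left hj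
  simp only [mul_add, mul_ite, mul_one, mul_zero]
  omega

/-- Multiplying by a transposition of points of different cycles merges these cycles. -/
lemma sameCycle_swap_mul_of_not {n : ℕ} (σ : Perm (Fin n)) {a b : Fin n}
    (h : ¬ σ.SameCycle a b) : (swap a b * σ).SameCycle a b := by
  have hL := cycLen_pos σ a
  obtain ⟨t, ht⟩ : ∃ t, cycLen σ a = t + 1 := ⟨cycLen σ a - 1, by omega⟩
  have : ((swap a b * σ) ^ (t + 1)) a = b := by
    rw [pow_succ', Perm.mul_apply, swap_mul_pow_apply, Perm.mul_apply, ← Perm.mul_apply σ,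
      ← pow_succ', ← ht, pow_cycLen_apply, swap_apply_left]
    intro m h0 hm
    refine ⟨fun he => ?_, fun he => h (he ▸ sameCycle_pow σ a m)⟩
    have := pow_apply_injOn σ a (s := m) (t := 0) (by omega) hL (by simpa using he)
    omega
  exact ⟨(t + 1 : ℕ), by rw [zpow_natCast]; exact this⟩

lemma exists_pow_of_not_sameCycle {n : ℕ} (σ : Perm (Fin n)) {a b : Fin n}
    (h : ¬ σ.SameCycle a b) :
    ∃ i, 0 < i ∧ i < cycLen (swap a b * σ) a ∧ ((swap a b * σ) ^ i) a = b ∧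
      cycLen σ a = i ∧ cycLen σ b = cycLen (swap a b * σ) a - i := by
  obtain ⟨i, hi, hb⟩ := exists_pow_apply_eq (sameCycle_swap_mul_of_not σ h)
  have hi0 : 0 < i := by
    rcases Nat.eq_zero_or_pos i with rfl | h0
    · exact absurd (by simpa using hb) fun he : a = b => h (he ▸ Perm.SameCycle.refl σ a)
    · exact h0
  have h1 := cycLen_swap_mul_left (swap a b * σ) a hi0 hi
  have h2 := cycLen_swap_mul_right (swap a b * σ) a hi0 hi
  rw [hb, swap_mul_self_mul] at h1 h2
  exact ⟨i, hi0, hi, hb, h1, h2⟩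

lemma cycLen_merge {n : ℕ} (σ : Perm (Fin n)) {a b : Fin n} (h : ¬ σ.SameCycle a b) :
    cycLen (swap a b * σ) a = cycLen σ a + cycLen σ b := by
  obtain ⟨i, h0, hi, hb, h1, h2⟩ := exists_pow_of_not_sameCycle σ h
  omega

lemma cycleCount_merge {n : ℕ} (σ : Perm (Fin n)) {a b : Fin n} (h : ¬ σ.SameCycle a b)
    {j : ℕ} (hj : 0 < j) :
    cycleCount σ j + (if cycLen σ a + cycLen σ b = j then 1 else 0)
      = cycleCount (swap a b * σ) j + (if cycLen σ a = j then 1 else 0)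
        + (if cycLen σ b = j then 1 else 0) := by
  obtain ⟨i, h0, hi, hb, h1, h2⟩ := exists_pow_of_not_sameCycle σ h
  have := cycleCount_split (swap a b * σ) a h0 hi hj
  rwa [hb, swap_mul_self_mul, ← h2, ← h1, cycLen_merge σ h] at this

lemma swap_mul_mem_Snr_of_pow {n r : ℕ} {σ : Perm (Fin n)} (hσ : σ ∈ Snr n r) (a : Fin n) {i : ℕ}
    (hi0 : 0 < i) (hi : i < cycLen σ a) : swap a ((σ ^ i) a) * σ ∈ Snr n r := by
  simp only [Snr, Finset.mem_filter, Finset.mem_univ, true_and] at hσ ⊢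
  intro x
  by_cases hx : σ.SameCycle a x
  · have ha := hσ a
    obtain ⟨m, hm, rfl⟩ := exists_pow_apply_eq hx
    by_cases h' : m < i
    · rw [← cycLen_eq_of_sameCycle
        ((sameCycle_swap_mul_iff σ a hi0 hi _).2 ⟨m, h', rfl⟩), cycLen_swap_mul_left σ a hi0 hi]
      omega
    · rw [← cycLen_eq_of_sameCycle
        ((sameCycle_swap_mul_right_iff σ a hi0 hi _).2 ⟨m, by omega, hm, rfl⟩),
        cycLen_swap_mul_right σ a hi0 hi]
      omega
  · rw [cycLen_swap_mul_of_not_sameCycle σ hx fun h => hx ((sameCycle_pow σ a i).trans h)]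
    exact hσ x

lemma swap_mul_mem_Snr_of_not_sameCycle {n r : ℕ} {σ : Perm (Fin n)} (hσ : σ ∈ Snr n r)
    {a b : Fin n} (h : ¬ σ.SameCycle a b) (hr : cycLen σ a + cycLen σ b ≤ r) :
    swap a b * σ ∈ Snr n r := by
  simp only [Snr, Finset.mem_filter, Finset.mem_univ, true_and] at hσ ⊢
  intro x
  by_cases hx : (swap a b * σ).SameCycle a x
  · rw [← cycLen_eq_of_sameCycle hx, cycLen_merge σ h]
    exact hr
  · have := cycLen_swap_mul_of_not_sameCycle (swap a b * σ) hx
      fun h' => hx ((sameCycle_swap_mul_of_not σ h).trans h')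
    rw [swap_mul_self_mul] at this
    exact this ▸ hσ x

/-- The number of `k`-cycles increases by one, and the numbers of `j`-cycles with
`k + 1 ≤ j ≤ d` do not change. -/
def CountEvent {n : ℕ} (d k : ℕ) (σ σ' : Perm (Fin n)) : Prop :=
  cycleCount σ' k = cycleCount σ k + 1 ∧
    ∀ j : ℕ, k + 1 ≤ j → j ≤ d → cycleCount σ' j = cycleCount σ j

lemma countEvent_step_of_pow {n r d k : ℕ} (hk : 1 ≤ k) (hkd : k ≤ d) {σ : Perm (Fin n)}
    (hσ : σ ∈ Snr n r) (a : Fin n) {i : ℕ} (hi0 : 0 < i) (hi : i < cycLen σ a) :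
    CountEvent d k σ (step n r σ (swap a ((σ ^ i) a))) ↔
      (d + k < cycLen σ a ∨ d < cycLen σ a ∧ cycLen σ a < 2 * k) ∧
        (i = k ∨ i = cycLen σ a - k) := by
  rw [CountEvent, step, if_pos (swap_mul_mem_Snr_of_pow hσ a hi0 hi)]
  have H := fun j (hj : 0 < j) => cycleCount_split σ a hi0 hi hj
  constructor
  · rintro ⟨h1, h2⟩
    have Hk := H k hk
    have hL : ¬ (k + 1 ≤ cycLen σ a ∧ cycLen σ a ≤ d) := by
      rintro ⟨h3, h4⟩
      have Hj := H (cycLen σ a) (by omega)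
      rw [h2 _ h3 h4] at Hj
      split_ifs at Hj <;> omega
    have hi1 : ¬ (k + 1 ≤ i ∧ i ≤ d) := by
      rintro ⟨h3, h4⟩
      have Hj := H i (by omega)
      rw [h2 _ h3 h4] at Hj
      split_ifs at Hj <;> omega
    have hi2 : ¬ (k + 1 ≤ cycLen σ a - i ∧ cycLen σ a - i ≤ d) := by
      rintro ⟨h3, h4⟩
      have Hj := H (cycLen σ a - i) (by omega)
      rw [h2 _ h3 h4] at Hj
      split_ifs at Hj <;> omega
    split_ifs at Hk <;> omega
  · rintro ⟨h1, h2⟩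
    constructor
    · have Hk := H k hk
      split_ifs at Hk <;> omega
    · intro j h3 h4
      have Hj := H j (by omega)
      split_ifs at Hj <;> omega

lemma countEvent_step_of_not_sameCycle {n r d k : ℕ} (hk : 1 ≤ k) (hkr : k ≤ r)
    {σ : Perm (Fin n)} (hσ : σ ∈ Snr n r) {a b : Fin n} (h : ¬ σ.SameCycle a b) :
    CountEvent d k σ (step n r σ (swap a b)) ↔ cycLen σ a + cycLen σ b = k := by
  have ha := cycLen_pos σ a
  have hb := cycLen_pos σ b
  rw [CountEvent, step]
  constructor
  · rintro ⟨h1, -⟩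
    have Hk := cycleCount_merge σ h hk
    split_ifs at h1 Hk <;> omega
  · intro he
    rw [if_pos (swap_mul_mem_Snr_of_not_sameCycle hσ h (by omega))]
    constructor
    · have Hk := cycleCount_merge σ h hk
      split_ifs at Hk <;> omega
    · intro j h3 h4
      have Hj := cycleCount_merge σ h (j := j) (by omega)
      split_ifs at Hj <;> omega

lemma card_filter_countEvent {n r d k : ℕ} (hk : 1 ≤ k) (hkd : k ≤ d) (hdr : d ≤ r)
    {σ : Perm (Fin n)} (hσ : σ ∈ Snr n r) (a : Fin n) :
    (((Finset.univ.erase a).filter fun b =>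
        CountEvent d k σ (step n r σ (swap a b))).card : ℝ)
      = 2 * ((if d + k < cycLen σ a then (1:ℝ) else 0)
            + (if d < cycLen σ a ∧ cycLen σ a < 2 * k then (1:ℝ) else 0))
        + ∑ b ∈ Finset.univ.erase a,
            (if ¬ σ.SameCycle a b ∧ cycLen σ a + cycLen σ b = k then (1:ℝ) else 0) := by
  rw [← Finset.card_filter_add_card_filter_not (fun b => σ.SameCycle a b),
    Finset.filter_filter, Finset.filter_filter, Nat.cast_add]
  congr 1
  · by_cases hc : d + k < cycLen σ a ∨ d < cycLen σ a ∧ cycLen σ a < 2 * k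
    · have hne : (σ ^ k) a ≠ (σ ^ (cycLen σ a - k)) a := fun h => by
        have := pow_apply_injOn σ a (by omega) (by omega) h
        omega
      have hset : ((Finset.univ.erase a).filter fun b =>
          CountEvent d k σ (step n r σ (swap a b)) ∧ σ.SameCycle a b)
          = {(σ ^ k) a, (σ ^ (cycLen σ a - k)) a} := by
        ext b
        simp only [Finset.mem_filter, Finset.mem_erase, Finset.mem_univ, and_true,
          Finset.mem_insert, Finset.mem_singleton]
        constructor
        · rintro ⟨hb, he, hs⟩
          obtain ⟨i, hi, rfl⟩ := exists_pow_apply_eq hs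
          have hi0 : 0 < i := Nat.pos_of_ne_zero fun h0 => hb (by simp [h0])
          rcases ((countEvent_step_of_pow hk hkd hσ a hi0 hi).1 he).2 with h | h
          · exact Or.inl (by rw [h])
          · exact Or.inr (by rw [← h])
        · have key : ∀ i, 0 < i → i < cycLen σ a → (i = k ∨ i = cycLen σ a - k) →
              (σ ^ i) a ≠ a ∧ CountEvent d k σ (step n r σ (swap a ((σ ^ i) a))) ∧
                σ.SameCycle a ((σ ^ i) a) := by
            intro i hi0 hi h
            refine ⟨fun he => ?_, (countEvent_step_of_pow hk hkd hσ a hi0 hi).2 ⟨hc, h⟩,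
              sameCycle_pow σ a i⟩
            have := pow_apply_injOn σ a (s := i) (t := 0) hi (by omega) (by simpa using he)
            omega
          rintro (rfl | rfl)
          · exact key k (by omega) (by omega) (Or.inl rfl)
          · exact key _ (by omega) (by omega) (Or.inr rfl)
      rw [hset, Finset.card_pair hne]
      rcases hc with hc | hc
      · rw [if_pos hc, if_neg (by omega)]; norm_num
      · rw [if_neg (by omega), if_pos hc]; norm_num
    · rw [if_neg (by tauto), if_neg (by tauto), Finset.filter_false_of_mem]
      · simp
      · rintro b hb ⟨he, hs⟩
        obtain ⟨i, hi, rfl⟩ := exists_pow_apply_eq hs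
        have hi0 : 0 < i := Nat.pos_of_ne_zero fun h0 => by simp [h0] at hb
        exact hc ((countEvent_step_of_pow hk hkd hσ a hi0 hi).1 he).1
  · rw [Finset.card_filter, Nat.cast_sum]
    refine Finset.sum_congr rfl fun b _ => ?_
    by_cases hs : σ.SameCycle a b
    · simp [hs]
    · simp [hs, countEvent_step_of_not_sameCycle hk (hkd.trans hdr) hσ hs]

lemma two_mul_card_filter_transps {n : ℕ} (P : Perm (Fin n) → Prop) :
    2 * ((transps n).filter P).card
      = ∑ a : Fin n, ((Finset.univ.erase a).filter fun b => P (swap a b)).card := by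
  rw [← Finset.card_sigma, Finset.card_eq_sum_card_fiberwise
    (f := fun p : (_ : Fin n) × Fin n => swap p.1 p.2) (t := (transps n).filter P)]
  · rw [Finset.sum_congr rfl (g := fun _ => 2)]
    · simp [mul_comm]
    · intro τ hτ
      simp only [transps, Finset.mem_filter, Finset.mem_univ, true_and] at hτ
      obtain ⟨⟨x, y, hxy, rfl⟩, hP⟩ := hτ
      rw [← Finset.card_pair (a := (⟨x, y⟩ : (_ : Fin n) × Fin n)) (b := ⟨y, x⟩)
        (by simpa using fun h => absurd h hxy)]
      congr 1
      ext ⟨u, v⟩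
      simp only [Finset.mem_filter, Finset.mem_sigma, Finset.mem_univ, true_and,
        Finset.mem_erase, and_true, Finset.mem_insert, Finset.mem_singleton, Sigma.mk.injEq,
        heq_eq_eq]
      constructor
      · rintro ⟨⟨hne, -⟩, he⟩
        have h1 := swap_apply_left u v
        rw [he, swap_apply_def] at h1
        split_ifs at h1 with hx hy
        · exact Or.inl ⟨hx, h1.symm⟩
        · exact Or.inr ⟨hy, h1.symm⟩
        · exact absurd h1.symm hne
      · rintro (⟨rfl, rfl⟩ | ⟨rfl, rfl⟩)
        · exact ⟨⟨fun h => hxy h.symm, hP⟩, rfl⟩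
        · exact ⟨⟨hxy, swap_comm u v ▸ hP⟩, swap_comm _ _⟩
  · rintro ⟨u, v⟩ h
    simp only [Finset.coe_sigma, Set.mem_sigma_iff, Finset.mem_coe, Finset.mem_univ, true_and,
      Finset.mem_filter, Finset.mem_erase, and_true, transps] at h ⊢
    exact ⟨⟨u, v, fun he => h.1 he.symm, rfl⟩, h.2⟩

lemma two_mul_card_transps (n : ℕ) : 2 * (transps n).card = n * (n - 1) := by
  have := two_mul_card_filter_transps (n := n) fun _ => True
  simpa [Finset.card_erase_of_mem] using this

/-- Exact formula for `P[A_k]`, the probability (over a uniform random transposition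
`τ`) that the number of `k`-cycles increases by one while the counts of `j`-cycles
for `k+1 ≤ j ≤ d` are unchanged. -/
theorem stmt12 (n r d k : ℕ) (hn : 2 ≤ n) (hk : 1 ≤ k) (hkd : k ≤ d) (hdr : d ≤ r)
    (hrn : r ≤ n) (σ : Equiv.Perm (Fin n)) (hσ : σ ∈ Snr n r) :
    (((transps n).filter (fun τ =>
          cycleCount (step n r σ τ) k = cycleCount σ k + 1 ∧
          ∀ j : ℕ, k + 1 ≤ j → j ≤ d →
            cycleCount (step n r σ τ) j = cycleCount σ j)).card : ℝ)
        / ((transps n).card : ℝ)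
      = 2 / ((n:ℝ) * ((n:ℝ) - 1)) *
          ∑ a : Fin n, ((if d + k < cycLen σ a then (1:ℝ) else 0)
            + (if d < cycLen σ a ∧ cycLen σ a < 2 * k then (1:ℝ) else 0))
        + 1 / ((n:ℝ) * ((n:ℝ) - 1)) *
            ∑ a : Fin n, ∑ b ∈ Finset.univ.erase a,
              (if ¬ σ.SameCycle a b ∧ cycLen σ a + cycLen σ b = k then (1:ℝ) else 0) := by
  have h1 := two_mul_card_filter_transps fun τ => CountEvent d k σ (step n r σ τ)
  have h2 := two_mul_card_transps n
  have h1' : (2:ℝ) * ((transps n).filter fun τ => CountEvent d k σ (step n r σ τ)).card =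
      ((∑ a : Fin n, ((Finset.univ.erase a).filter fun b =>
        CountEvent d k σ (step n r σ (swap a b))).card : ℕ) : ℝ) := by
    exact_mod_cast h1
  have h2' : (2:ℝ) * (transps n).card = n * ((n:ℝ) - 1) := by
    have h3 : ((n - 1 : ℕ) : ℝ) = (n:ℝ) - 1 := by
      rw [Nat.cast_sub (by omega), Nat.cast_one]
    rw [← h3]
    exact_mod_cast h2
  rw [Nat.cast_sum, Finset.sum_congr rfl fun a _ => card_filter_countEvent hk hkd hdr hσ a,
    Finset.sum_add_distrib, ← Finset.mul_sum] at h1'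
  have hE : ((transps n).filter fun τ =>
      cycleCount (step n r σ τ) k = cycleCount σ k + 1 ∧
      ∀ j : ℕ, k + 1 ≤ j → j ≤ d → cycleCount (step n r σ τ) j = cycleCount σ j)
      = (transps n).filter fun τ => CountEvent d k σ (step n r σ τ) := by
    ext τ
    rw [Finset.mem_filter, Finset.mem_filter, CountEvent]
  rw [hE, ← mul_div_mul_left _ _ (two_ne_zero (α := ℝ)), h1', h2']
  ring
end
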